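/- For every n ≥ 0, there exists a simple ψ-reduction grammar 𝒢_n; in particular, for every n ≥ 0, the set of λυ-terms that ψ-normalise in exactly n normal-order ψ-reduction steps is a regular tree language generated by a regular tree grammar over the λυ signature whose axiom is unambiguous. -/

import Mathlib

mutual
/-- λυ-terms in de Bruijn notation, with explicit closures. -/
inductive LTerm : Type
  | idx : Nat → LTerm
  | lam : LTerm → LTerm
  | app : LTerm → LTerm → LTerm
  | clos : LTerm → LSub → LTerm
  deriving DecidableEq

/-- explicit λυ-substitutions. -/
inductive LSub : Type
  | slash : LTerm → LSub
  | lift : LSub → LSub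
  | shift : LSub
  deriving DecidableEq
end

mutual
/-- natural size of a λυ-term: the number of constructors (|idx n| = n+1). -/
def LTerm.size : LTerm → Nat
  | .idx n => n + 1
  | .lam a => 1 + a.size
  | .app a b => 1 + a.size + b.size
  | .clos a s => 1 + a.size + s.size

/-- natural size of a substitution. -/
def LSub.size : LSub → Nat
  | .slash a => 1 + a.size
  | .lift s => 1 + s.size
  | .shift => 1
end

/-- a λυ-term is pure if it contains no closure; pure terms are exactly the ψ-normal forms. -/
def LTerm.IsPure : LTerm → Prop
  | .idx _ => True
  | .lam a => a.IsPure
  | .app a b => a.IsPure ∧ b.IsPure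
  | .clos _ _ => False

/-- one normal-order (leftmost-outermost) ψ-reduction step. -/
inductive NStep : LTerm → LTerm → Prop
  /-- (App) (ab)[s] → a[s](b[s]) -/
  | appS (a b : LTerm) (s : LSub) :
      NStep (.clos (.app a b) s) (.app (.clos a s) (.clos b s))
  /-- (Lambda) (λa)[s] → λ(a[⇑(s)]) -/
  | lamS (a : LTerm) (s : LSub) :
      NStep (.clos (.lam a) s) (.lam (.clos a (.lift s)))
  /-- (FVar) 0[a/] → a -/
  | fvar (a : LTerm) : NStep (.clos (.idx 0) (.slash a)) a
  /-- (RVar) (S n)[a/] → n -/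
  | rvar (n : Nat) (a : LTerm) : NStep (.clos (.idx (n+1)) (.slash a)) (.idx n)
  /-- (FVarLift) 0[⇑(s)] → 0 -/
  | fvarLift (s : LSub) : NStep (.clos (.idx 0) (.lift s)) (.idx 0)
  /-- (RVarLift) (S n)[⇑(s)] → n[s][↑] -/
  | rvarLift (n : Nat) (s : LSub) :
      NStep (.clos (.idx (n+1)) (.lift s)) (.clos (.clos (.idx n) s) .shift)
  /-- (VarShift) n[↑] → S n -/
  | varShift (n : Nat) : NStep (.clos (.idx n) .shift) (.idx (n+1))
  /-- reduce under an abstraction -/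
  | lamCong {a a' : LTerm} : NStep a a' → NStep (.lam a) (.lam a')
  /-- reduce in the left part of an application -/
  | appLeft {a a' : LTerm} (b : LTerm) : NStep a a' → NStep (.app a b) (.app a' b)
  /-- reduce in the right part of an application, provided the left part is normal -/
  | appRight {b b' : LTerm} (a : LTerm) :
      a.IsPure → NStep b b' → NStep (.app a b) (.app a b')
  /-- reduce in the body of a closure, provided the closure is not itself a ψ-redex,
      i.e. its body is again a closure -/
  | closCong {t t' : LTerm} (s : LSub) :
      (∃ u v, t = LTerm.clos u v) → NStep t t' → NStep (.clos t s) (.clos t' s)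

/-- `NormIn t k` : `t` reaches its ψ-normal form in exactly `k` normal-order
ψ-reduction steps (written t ↓_k). -/
inductive NormIn : LTerm → Nat → Prop
  | base {t : LTerm} : t.IsPure → NormIn t 0
  | step {t t' : LTerm} {k : Nat} : NStep t t' → NormIn t' k → NormIn t (k+1)

/-! ## Regular tree grammars over the λυ signature -/

/-- terms over the ranked alphabet of λυ (terminal symbols 0, S, λ, application,
closure, slash, lift, shift) with variables (non-terminals) in `V`.
Ground terms are `GTerm Empty`. -/
inductive GTerm (V : Type) : Type
  | var : V → GTerm V
  | zero : GTerm V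
  | succ : GTerm V → GTerm V
  | lam : GTerm V → GTerm V
  | app : GTerm V → GTerm V → GTerm V
  | clos : GTerm V → GTerm V → GTerm V
  | slash : GTerm V → GTerm V
  | lift : GTerm V → GTerm V
  | shift : GTerm V
  deriving DecidableEq

/-- `Gen P α t` : the ground term `t` is derivable from the term `α` in the
regular tree grammar with production function `P`. -/
inductive Gen {V : Type} (P : V → Set (GTerm V)) : GTerm V → GTerm Empty → Prop
  | var {X : V} {γ : GTerm V} {t : GTerm Empty} :
      γ ∈ P X → Gen P γ t → Gen P (.var X) t
  | zero : Gen P .zero .zero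
  | succ {a t} : Gen P a t → Gen P (.succ a) (.succ t)
  | lam {a t} : Gen P a t → Gen P (.lam a) (.lam t)
  | app {a b t u} : Gen P a t → Gen P b u → Gen P (.app a b) (.app t u)
  | clos {a b t u} : Gen P a t → Gen P b u → Gen P (.clos a b) (.clos t u)
  | slash {a t} : Gen P a t → Gen P (.slash a) (.slash t)
  | lift {a t} : Gen P a t → Gen P (.lift a) (.lift t)
  | shift : Gen P .shift .shift

/-- the language generated by a term `α` in the grammar with productions `P`. -/
def Lang {V : Type} (P : V → Set (GTerm V)) (α : GTerm V) : Set (GTerm Empty) :=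
  {t | Gen P α t}

/-- derivations (parse trees) of a ground term from a term `α`; a grammar is
unambiguous when such derivations are unique. -/
inductive Parse {V : Type} (P : V → Set (GTerm V)) : GTerm V → GTerm Empty → Type
  | var {X : V} {γ : GTerm V} {t : GTerm Empty} :
      γ ∈ P X → Parse P γ t → Parse P (.var X) t
  | zero : Parse P .zero .zero
  | succ {a t} : Parse P a t → Parse P (.succ a) (.succ t)
  | lam {a t} : Parse P a t → Parse P (.lam a) (.lam t)
  | app {a b t u} : Parse P a t → Parse P b u → Parse P (.app a b) (.app t u)
  | clos {a b t u} : Parse P a t → Parse P b u → Parse P (.clos a b) (.clos t u)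
  | slash {a t} : Parse P a t → Parse P (.slash a) (.slash t)
  | lift {a t} : Parse P a t → Parse P (.lift a) (.lift t)
  | shift : Parse P .shift .shift

/-- a non-terminal `X` is unambiguous if every ground term admits at most one
derivation sequence (equivalently, parse tree) from `X`. -/
def Unambiguous {V : Type} (P : V → Set (GTerm V)) (X : V) : Prop :=
  ∀ t : GTerm Empty, Subsingleton (Parse P (.var X) t)

/-- `Occurs X α` : the non-terminal `X` occurs in the term `α`. -/
def Occurs {V : Type} (X : V) : GTerm V → Prop
  | .var Y => X = Y
  | .zero => False
  | .succ a => Occurs X a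
  | .lam a => Occurs X a
  | .app a b => Occurs X a ∨ Occurs X b
  | .clos a b => Occurs X a ∨ Occurs X b
  | .slash a => Occurs X a
  | .lift a => Occurs X a
  | .shift => False

/-- the head of a term `χ[σ_1]⋯[σ_w]` of closure width `w`, namely `χ`. -/
def headOf {V : Type} : GTerm V → GTerm V
  | .clos a _ => headOf a
  | t => t

/-- the closure width of a term: the largest `w` such that the term has the
form `χ[σ_1]⋯[σ_w]`. -/
def closWidth {V : Type} : GTerm V → Nat
  | .clos a _ => closWidth a + 1
  | _ => 0

/-- a regular tree grammar over the λυ terminal alphabet, with non-terminals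
`V`, axiom `ax` and a finite set of productions for each non-terminal. -/
structure RTG (V : Type) where
  ax : V
  prods : V → Set (GTerm V)
  prods_fin : ∀ X, (prods X).Finite

/-- non-terminal symbols of the ψ-reduction grammar 𝒢_n : the standard
non-terminals T, S, N of the grammar Λ of λυ-terms, plus G_0, …, G_n. -/
inductive NT (n : Nat) : Type
  | T : NT n
  | S : NT n
  | N : NT n
  | G : Fin (n+1) → NT n
  deriving DecidableEq

/-- the productions of the standard regular tree grammar Λ of λυ-terms:
T → N | λT | T T | T[S],  S → T/ | ⇑(S) | ↑,  N → 0 | S N. -/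
def lamProds {n : Nat} : NT n → Set (GTerm (NT n))
  | .T => {GTerm.var (NT.N), GTerm.lam (.var .T), GTerm.app (.var .T) (.var .T),
           GTerm.clos (.var .T) (.var .S)}
  | .S => {GTerm.slash (.var .T), GTerm.lift (.var .S), GTerm.shift}
  | .N => {GTerm.zero, GTerm.succ (.var .N)}
  | .G _ => ∅

/-- encoding of de Bruijn indices as ground terms. -/
def encIdx : Nat → GTerm Empty
  | 0 => .zero
  | n+1 => .succ (encIdx n)

mutual
/-- encoding of λυ-terms as ground terms over the λυ alphabet. -/
def encT : LTerm → GTerm Empty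
  | .idx n => encIdx n
  | .lam a => .lam (encT a)
  | .app a b => .app (encT a) (encT b)
  | .clos a s => .clos (encT a) (encS s)

/-- encoding of λυ-substitutions as ground terms over the λυ alphabet. -/
def encS : LSub → GTerm Empty
  | .slash a => .slash (encT a)
  | .lift s => .lift (encS s)
  | .shift => .shift
end

/-- `IsRG n G` : `G` is a ψ-reduction grammar 𝒢_n : a regular tree grammar
over the λυ alphabet with non-terminals T, S, N, G_0, …, G_n, whose axiom is
G_n, whose productions include those of the grammar Λ of λυ-terms, and such
that each G_k is unambiguous and generates exactly the (encodings of) λυ-terms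
ψ-normalising in k normal-order ψ-reduction steps. -/
structure IsRG (n : Nat) (G : RTG (NT n)) : Prop where
  ax_eq : G.ax = NT.G (Fin.last n)
  lambda_sub : ∀ X : NT n, lamProds X ⊆ G.prods X
  unamb : ∀ k : Fin (n+1), Unambiguous G.prods (NT.G k)
  lang : ∀ k : Fin (n+1),
    Lang G.prods (.var (NT.G k)) = {g | ∃ t : LTerm, NormIn t k ∧ encT t = g}

/-- `IsSimple n G` : the ψ-reduction grammar is simple: every self-referencing
production is a production of Λ or has one of the forms
G_k → λG_k | G_0 G_k | G_k G_0, and every regular (non-self-referencing)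
production G_k → α references only the non-terminals T, S, N, G_0, …, G_{k−1}. -/
structure IsSimple (n : Nat) (G : RTG (NT n)) : Prop where
  selfref : ∀ (X : NT n) (α : GTerm (NT n)), α ∈ G.prods X → Occurs X α →
    α ∈ lamProds X ∨
      ∃ k : Fin (n+1), X = NT.G k ∧
        (α = .lam (.var X) ∨ α = .app (.var (NT.G 0)) (.var X) ∨
          α = .app (.var X) (.var (NT.G 0)))
  regular : ∀ (k : Fin (n+1)) (α : GTerm (NT n)),
    α ∈ G.prods (NT.G k) → ¬ Occurs (NT.G k) α →
      ∀ Y : NT n, Occurs Y α →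
        Y = NT.T ∨ Y = NT.S ∨ Y = NT.N ∨ ∃ j : Fin (n+1), Y = NT.G j ∧ (j : ℕ) < (k : ℕ)

/-- `IsVerbose G` : no production has the form X → G_k[σ_1]⋯[σ_w]. -/
def IsVerbose {n : Nat} (G : RTG (NT n)) : Prop :=
  ∀ (X : NT n) (α : GTerm (NT n)), α ∈ G.prods X →
    ∀ k : Fin (n+1), headOf α ≠ .var (NT.G k)

/-! ## Normalisation length -/

theorem LTerm.IsPure.not_step {t t' : LTerm} (h : NStep t t') : ¬ t.IsPure := by
  induction h <;> simp_all [LTerm.IsPure]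

theorem NStep.det {t u v : LTerm} (h : NStep t u) (h' : NStep t v) : u = v := by
  induction h generalizing v with
  | lamCong _ ih => cases h' with | lamCong h' => rw [ih h']
  | appLeft b h ih =>
    cases h' with
    | appLeft _ h' => rw [ih h']
    | appRight _ hp _ => exact absurd hp (LTerm.IsPure.not_step h)
  | appRight a hp h ih =>
    cases h' with
    | appLeft _ h' => exact absurd hp (LTerm.IsPure.not_step h')
    | appRight _ _ h' => rw [ih h']
  | closCong s hc h ih =>
    obtain ⟨u, v, rfl⟩ := hc
    cases h' with
    | closCong _ _ h' => rw [ih h']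
  | _ =>
    cases h' with
    | closCong _ hc _ => obtain ⟨_, _, hc⟩ := hc; cases hc
    | _ => rfl

theorem normIn_iff_of_step {t u : LTerm} (h : NStep t u) {k : ℕ} :
    NormIn t k ↔ ∃ j, k = j + 1 ∧ NormIn u j := by
  constructor
  · intro hk
    cases hk with
    | base hp => exact absurd hp (LTerm.IsPure.not_step h)
    | step h' hk => exact ⟨_, rfl, h.det h' ▸ hk⟩
  · rintro ⟨j, rfl, hj⟩
    exact .step h hj

theorem NormIn.unique {t : LTerm} {i j : ℕ} (hi : NormIn t i) (hj : NormIn t j) : i = j := by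
  induction hi generalizing j with
  | base hp =>
    cases hj with
    | base => rfl
    | step h => exact absurd hp (LTerm.IsPure.not_step h)
  | step h _ ih =>
    obtain ⟨j', rfl, hj'⟩ := (normIn_iff_of_step h).1 hj
    rw [ih hj']

theorem normIn_idx_iff {m k : ℕ} : NormIn (.idx m) k ↔ k = 0 := by
  constructor
  · intro h
    cases h with
    | base => rfl
    | step h => cases h
  · rintro rfl
    exact .base trivial

theorem normIn_lam_iff {a : LTerm} {k : ℕ} : NormIn (.lam a) k ↔ NormIn a k := by
  constructor
  · intro h
    generalize ht : LTerm.lam a = t at h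
    induction h generalizing a with
    | base hp => subst ht; exact .base hp
    | step h _ ih =>
      subst ht
      cases h with
      | lamCong h => exact .step h (ih rfl)
  · intro h
    induction h with
    | base hp => exact .base hp
    | step h _ ih => exact .step (.lamCong h) ih

theorem normIn_app_iff {a b : LTerm} {k : ℕ} :
    NormIn (.app a b) k ↔ ∃ i j, i + j = k ∧ NormIn a i ∧ NormIn b j := by
  constructor
  · intro h
    generalize ht : LTerm.app a b = t at h
    induction h generalizing a b with
    | base hp => subst ht; exact ⟨0, 0, rfl, .base hp.1, .base hp.2⟩
    | step h _ ih =>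
      subst ht
      cases h with
      | appLeft _ h =>
        obtain ⟨i, j, rfl, hi, hj⟩ := ih rfl
        exact ⟨i + 1, j, by omega, .step h hi, hj⟩
      | appRight _ hp h =>
        obtain ⟨i, j, rfl, hi, hj⟩ := ih rfl
        exact ⟨i, j + 1, by omega, hi, .step h hj⟩
  · rintro ⟨i, j, rfl, hi, hj⟩
    induction hi with
    | base hp =>
      rw [Nat.zero_add]
      induction hj with
      | base hq => exact .base ⟨hp, hq⟩
      | step h _ ih => exact .step (.appRight _ hp h) ih
    | @step _ _ i h _ ih =>
      rw [Nat.add_right_comm]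
      exact .step (.appLeft _ h) ih

/-- `a.closs [σ₁, …, σ_w]` is the iterated closure `a[σ₁]⋯[σ_w]`. -/
def LTerm.closs (a : LTerm) (l : List LSub) : LTerm := l.foldl .clos a

@[simp] theorem LTerm.closs_nil (a : LTerm) : a.closs [] = a := rfl

@[simp] theorem LTerm.closs_cons (a : LTerm) (s : LSub) (l : List LSub) :
    a.closs (s :: l) = (LTerm.clos a s).closs l := rfl

theorem NStep.closs {a : LTerm} {s : LSub} {u : LTerm} (h : NStep (.clos a s) u)
    (l : List LSub) : NStep (a.closs (s :: l)) (u.closs l) := by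
  induction l using List.reverseRecOn with
  | nil => exact h
  | append_singleton l r ih =>
    simp only [LTerm.closs, List.foldl_append, List.foldl_cons, List.foldl_nil] at ih ⊢
    refine .closCong r ?_ ih
    clear ih
    induction l using List.reverseRecOn with
    | nil => exact ⟨a, s, rfl⟩
    | append_singleton l q _ => simp

theorem normIn_closs_cons_iff {a : LTerm} {s : LSub} {u : LTerm} (h : NStep (.clos a s) u)
    {l : List LSub} {k : ℕ} :
    NormIn (a.closs (s :: l)) k ↔ ∃ j, k = j + 1 ∧ NormIn (u.closs l) j :=
  normIn_iff_of_step (h.closs l)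

theorem normIn_closs_lam_iff {a : LTerm} {l : List LSub} {k : ℕ} :
    NormIn ((LTerm.lam a).closs l) k ↔
      ∃ j, k = j + l.length ∧ NormIn (a.closs (l.map .lift)) j := by
  induction l generalizing a k with
  | nil => simp [normIn_lam_iff]
  | cons s l ih =>
    rw [normIn_closs_cons_iff (.lamS a s)]
    simp only [ih, List.length_cons, List.map_cons, LTerm.closs_cons]
    constructor
    · rintro ⟨_, rfl, j, rfl, hj⟩
      exact ⟨j, by omega, hj⟩
    · rintro ⟨j, rfl, hj⟩
      exact ⟨j + l.length, by omega, j, rfl, hj⟩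

theorem normIn_closs_app_iff {a b : LTerm} {l : List LSub} {k : ℕ} :
    NormIn ((LTerm.app a b).closs l) k ↔
      ∃ i j, i + j + l.length = k ∧ NormIn (a.closs l) i ∧ NormIn (b.closs l) j := by
  induction l generalizing a b k with
  | nil => simp [normIn_app_iff]
  | cons s l ih =>
    rw [normIn_closs_cons_iff (.appS a b s)]
    simp only [ih, List.length_cons, LTerm.closs_cons]
    constructor
    · rintro ⟨_, rfl, i, j, rfl, hij⟩
      exact ⟨i, j, by omega, hij⟩
    · rintro ⟨i, j, rfl, hij⟩
      exact ⟨i + j + l.length, by omega, i, j, rfl, hij⟩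

/-- the number of closures wrapped around the head of a λυ-term. -/
def LTerm.width : LTerm → ℕ
  | .clos a _ => a.width + 1
  | _ => 0

theorem NStep.width_le {t u : LTerm} (h : NStep t u) : t.width ≤ u.width + 1 := by
  induction h <;> simp_all [LTerm.width]

theorem NormIn.width_le {t : LTerm} {k : ℕ} (h : NormIn t k) : t.width ≤ k := by
  induction h with
  | @base t hp => cases t <;> simp_all [LTerm.width, LTerm.IsPure]
  | step h _ ih => exact h.width_le.trans (by omega)

theorem LTerm.length_le_width_closs (a : LTerm) (l : List LSub) :
    l.length ≤ (a.closs l).width := by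
  induction l using List.reverseRecOn with
  | nil => simp
  | append_singleton l s ih =>
    simp only [LTerm.closs, List.foldl_append, List.foldl_cons, List.foldl_nil] at ih ⊢
    simpa [LTerm.width] using ih

/-- case analysis on ground terms, which are never variables. -/
@[elab_as_elim]
theorem GTerm.ground_cases {motive : GTerm Empty → Prop} (x : GTerm Empty)
    (zero : motive .zero) (succ : ∀ a, motive (.succ a)) (lam : ∀ a, motive (.lam a))
    (app : ∀ a b, motive (.app a b)) (clos : ∀ a b, motive (.clos a b))
    (slash : ∀ a, motive (.slash a)) (lift : ∀ a, motive (.lift a))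
    (shift : motive .shift) : motive x := by
  cases x with
  | var v => exact v.elim
  | _ => apply_assumption

/-! ## The languages denoted by the non-terminals -/

@[simp] theorem encIdx_inj {m n : ℕ} : encIdx m = encIdx n ↔ m = n := by
  induction m generalizing n with
  | zero => cases n <;> simp [encIdx]
  | succ m ih => cases n <;> simp [encIdx, ih]


mutual
theorem encT_injective : ∀ {t u : LTerm}, encT t = encT u → t = u
  | .idx m, u, h => by
    cases u with
    | idx => simpa [encT] using h
    | _ => cases m <;> simp [encT, encIdx] at h
  | .lam a, u, h => by
    cases u with
    | idx m => cases m <;> simp [encT, encIdx] at h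
    | lam b => simp only [encT, GTerm.lam.injEq] at h; rw [encT_injective h]
    | _ => simp [encT] at h
  | .app a b, u, h => by
    cases u with
    | idx m => cases m <;> simp [encT, encIdx] at h
    | app c d =>
      simp only [encT, GTerm.app.injEq] at h
      rw [encT_injective h.1, encT_injective h.2]
    | _ => simp [encT] at h
  | .clos a s, u, h => by
    cases u with
    | idx m => cases m <;> simp [encT, encIdx] at h
    | clos c r =>
      simp only [encT, GTerm.clos.injEq] at h
      rw [encT_injective h.1, encS_injective h.2]
    | _ => simp [encT] at h
theorem encS_injective : ∀ {s r : LSub}, encS s = encS r → s = r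
  | .slash a, r, h => by
    cases r with
    | slash b => simp only [encS, GTerm.slash.injEq] at h; rw [encT_injective h]
    | _ => simp [encS] at h
  | .lift a, r, h => by
    cases r with
    | lift b => simp only [encS, GTerm.lift.injEq] at h; rw [encS_injective h]
    | _ => simp [encS] at h
  | .shift, r, h => by cases r <;> simp [encS] at h ⊢
end

/-- the ground encodings of λυ-terms. -/
def setT : Set (GTerm Empty) := Set.range encT

/-- the ground encodings of substitutions. -/
def setS : Set (GTerm Empty) := Set.range encS

/-- the ground encodings of de Bruijn indices. -/
def setN : Set (GTerm Empty) := Set.range encIdx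

/-- the ground encodings of λυ-terms normalising in `k` steps. -/
def setG (k : ℕ) : Set (GTerm Empty) := {g | ∃ t : LTerm, NormIn t k ∧ encT t = g}

/-- the ground encodings of closures normalising in `k` steps. -/
def setD (k : ℕ) : Set (GTerm Empty) :=
  encT '' {t | ∃ a s, t = .clos a s ∧ NormIn (.clos a s) k}

section Membership

variable {x y : GTerm Empty} {k : ℕ}

@[simp] theorem zero_mem_setN : .zero ∈ setN := ⟨0, rfl⟩
@[simp] theorem succ_mem_setN : .succ x ∈ setN ↔ x ∈ setN := by
  constructor
  · rintro ⟨_ | m, h⟩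
    · simp [encIdx] at h
    · exact ⟨m, by simpa [encIdx] using h⟩
  · rintro ⟨m, rfl⟩; exact ⟨m + 1, rfl⟩
@[simp] theorem lam_not_mem_setN : .lam x ∉ setN := by
  rintro ⟨_ | m, h⟩ <;> simp [encIdx] at h
@[simp] theorem app_not_mem_setN : .app x y ∉ setN := by
  rintro ⟨_ | m, h⟩ <;> simp [encIdx] at h
@[simp] theorem clos_not_mem_setN : .clos x y ∉ setN := by
  rintro ⟨_ | m, h⟩ <;> simp [encIdx] at h
@[simp] theorem slash_not_mem_setN : .slash x ∉ setN := by
  rintro ⟨_ | m, h⟩ <;> simp [encIdx] at h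
@[simp] theorem lift_not_mem_setN : .lift x ∉ setN := by
  rintro ⟨_ | m, h⟩ <;> simp [encIdx] at h
@[simp] theorem shift_not_mem_setN : .shift ∉ setN := by
  rintro ⟨_ | m, h⟩ <;> simp [encIdx] at h

@[simp] theorem zero_mem_setG : .zero ∈ setG k ↔ k = 0 := by
  constructor
  · rintro ⟨t, ht, h⟩
    cases t with
    | idx => exact normIn_idx_iff.1 ht
    | _ => simp [encT] at h
  · rintro rfl; exact ⟨.idx 0, .base trivial, rfl⟩
@[simp] theorem succ_mem_setG : .succ x ∈ setG k ↔ k = 0 ∧ x ∈ setN := by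
  constructor
  · rintro ⟨t, ht, h⟩
    cases t with
    | idx m => exact ⟨normIn_idx_iff.1 ht, succ_mem_setN.1 ⟨m, h⟩⟩
    | _ => simp [encT] at h
  · rintro ⟨rfl, m, rfl⟩; exact ⟨.idx (m + 1), .base trivial, rfl⟩
@[simp] theorem lam_mem_setG : .lam x ∈ setG k ↔ x ∈ setG k := by
  constructor
  · rintro ⟨t, ht, h⟩
    cases t with
    | idx m => cases m <;> simp [encT, encIdx] at h
    | lam a => exact ⟨a, normIn_lam_iff.1 ht, by simpa [encT] using h⟩
    | _ => simp [encT] at h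
  · rintro ⟨a, ha, rfl⟩; exact ⟨.lam a, normIn_lam_iff.2 ha, rfl⟩
@[simp] theorem app_mem_setG :
    .app x y ∈ setG k ↔ ∃ i j, i + j = k ∧ x ∈ setG i ∧ y ∈ setG j := by
  constructor
  · rintro ⟨t, ht, h⟩
    cases t with
    | idx m => cases m <;> simp [encT, encIdx] at h
    | app a b =>
      obtain ⟨i, j, hk, hi, hj⟩ := normIn_app_iff.1 ht
      simp only [encT, GTerm.app.injEq] at h
      exact ⟨i, j, hk, ⟨a, hi, h.1⟩, ⟨b, hj, h.2⟩⟩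
    | _ => simp [encT] at h
  · rintro ⟨i, j, hk, ⟨a, ha, rfl⟩, ⟨b, hb, rfl⟩⟩
    exact ⟨.app a b, normIn_app_iff.2 ⟨i, j, hk, ha, hb⟩, rfl⟩
@[simp] theorem clos_mem_setG : .clos x y ∈ setG k ↔ .clos x y ∈ setD k := by
  constructor
  · rintro ⟨t, ht, h⟩
    cases t with
    | idx m => cases m <;> simp [encT, encIdx] at h
    | clos a s => exact ⟨_, ⟨a, s, rfl, ht⟩, h⟩
    | _ => simp [encT] at h
  · rintro ⟨_, ⟨a, s, rfl, ht⟩, h⟩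
    exact ⟨_, ht, h⟩
@[simp] theorem slash_not_mem_setG : .slash x ∉ setG k := by
  rintro ⟨(_ | _) | _, _, h⟩ <;> simp [encT, encIdx] at h
@[simp] theorem lift_not_mem_setG : .lift x ∉ setG k := by
  rintro ⟨(_ | _) | _, _, h⟩ <;> simp [encT, encIdx] at h
@[simp] theorem shift_not_mem_setG : .shift ∉ setG k := by
  rintro ⟨(_ | _) | _, _, h⟩ <;> simp [encT, encIdx] at h

@[simp] theorem zero_mem_setT : .zero ∈ setT := ⟨.idx 0, rfl⟩
@[simp] theorem succ_mem_setT : .succ x ∈ setT ↔ x ∈ setN := by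
  constructor
  · rintro ⟨t, h⟩
    cases t with
    | idx m => exact succ_mem_setN.1 ⟨m, h⟩
    | _ => simp [encT] at h
  · rintro ⟨m, rfl⟩; exact ⟨.idx (m + 1), rfl⟩
@[simp] theorem lam_mem_setT : .lam x ∈ setT ↔ x ∈ setT := by
  constructor
  · rintro ⟨t, h⟩
    cases t with
    | idx m => cases m <;> simp [encT, encIdx] at h
    | lam a => exact ⟨a, by simpa [encT] using h⟩
    | _ => simp [encT] at h
  · rintro ⟨a, rfl⟩; exact ⟨.lam a, rfl⟩
@[simp] theorem app_mem_setT : .app x y ∈ setT ↔ x ∈ setT ∧ y ∈ setT := by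
  constructor
  · rintro ⟨t, h⟩
    cases t with
    | idx m => cases m <;> simp [encT, encIdx] at h
    | app a b =>
      simp only [encT, GTerm.app.injEq] at h
      exact ⟨⟨a, h.1⟩, ⟨b, h.2⟩⟩
    | _ => simp [encT] at h
  · rintro ⟨⟨a, rfl⟩, ⟨b, rfl⟩⟩; exact ⟨.app a b, rfl⟩
@[simp] theorem clos_mem_setT : .clos x y ∈ setT ↔ x ∈ setT ∧ y ∈ setS := by
  constructor
  · rintro ⟨t, h⟩
    cases t with
    | idx m => cases m <;> simp [encT, encIdx] at h
    | clos a s =>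
      simp only [encT, GTerm.clos.injEq] at h
      exact ⟨⟨a, h.1⟩, ⟨s, h.2⟩⟩
    | _ => simp [encT] at h
  · rintro ⟨⟨a, rfl⟩, ⟨s, rfl⟩⟩; exact ⟨.clos a s, rfl⟩
@[simp] theorem slash_not_mem_setT : .slash x ∉ setT := by
  rintro ⟨(_ | _) | _, h⟩ <;> simp [encT, encIdx] at h
@[simp] theorem lift_not_mem_setT : .lift x ∉ setT := by
  rintro ⟨(_ | _) | _, h⟩ <;> simp [encT, encIdx] at h
@[simp] theorem shift_not_mem_setT : .shift ∉ setT := by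
  rintro ⟨(_ | _) | _, h⟩ <;> simp [encT, encIdx] at h

@[simp] theorem slash_mem_setS : .slash x ∈ setS ↔ x ∈ setT := by
  constructor
  · rintro ⟨s, h⟩
    cases s with
    | slash a => exact ⟨a, by simpa [encS] using h⟩
    | _ => simp [encS] at h
  · rintro ⟨a, rfl⟩; exact ⟨.slash a, rfl⟩
@[simp] theorem lift_mem_setS : .lift x ∈ setS ↔ x ∈ setS := by
  constructor
  · rintro ⟨s, h⟩
    cases s with
    | lift a => exact ⟨a, by simpa [encS] using h⟩
    | _ => simp [encS] at h
  · rintro ⟨a, rfl⟩; exact ⟨.lift a, rfl⟩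
@[simp] theorem shift_mem_setS : .shift ∈ setS := ⟨.shift, rfl⟩
@[simp] theorem zero_not_mem_setS : .zero ∉ setS := by
  rintro ⟨_ | _, h⟩ <;> simp [encS] at h
@[simp] theorem succ_not_mem_setS : .succ x ∉ setS := by
  rintro ⟨_ | _, h⟩ <;> simp [encS] at h
@[simp] theorem lam_not_mem_setS : .lam x ∉ setS := by
  rintro ⟨_ | _, h⟩ <;> simp [encS] at h
@[simp] theorem app_not_mem_setS : .app x y ∉ setS := by
  rintro ⟨_ | _, h⟩ <;> simp [encS] at h
@[simp] theorem clos_not_mem_setS : .clos x y ∉ setS := by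
  rintro ⟨_ | _, h⟩ <;> simp [encS] at h

@[simp] theorem app_mem_image2 {A B : Set (GTerm Empty)} :
    GTerm.app x y ∈ Set.image2 GTerm.app A B ↔ x ∈ A ∧ y ∈ B :=
  Set.mem_image2_iff (fun _ _ _ _ h => by simpa using h)
@[simp] theorem clos_mem_image2 {A B : Set (GTerm Empty)} :
    GTerm.clos x y ∈ Set.image2 GTerm.clos A B ↔ x ∈ A ∧ y ∈ B :=
  Set.mem_image2_iff (fun _ _ _ _ h => by simpa using h)

end Membership

theorem setN_subset_setT : setN ⊆ setT := by
  rintro _ ⟨m, rfl⟩; exact ⟨.idx m, rfl⟩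

theorem setG_subset_setT (k : ℕ) : setG k ⊆ setT := by
  rintro _ ⟨t, _, rfl⟩; exact ⟨t, rfl⟩

theorem setN_subset_setG_zero : setN ⊆ setG 0 := by
  rintro _ ⟨m, rfl⟩; exact ⟨.idx m, .base trivial, rfl⟩

theorem eq_of_mem_setG {x : GTerm Empty} {i j : ℕ} (hi : x ∈ setG i) (hj : x ∈ setG j) :
    i = j := by
  obtain ⟨t, ht, rfl⟩ := hi
  obtain ⟨u, hu, h⟩ := hj
  cases encT_injective h
  exact ht.unique hu

theorem not_mem_setS_of_mem_setT {x : GTerm Empty} (h : x ∈ setT) : x ∉ setS := by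
  cases x using GTerm.ground_cases <;> simp_all

/-! ## Finite disjoint unions of pattern languages -/

/-- `PatLang k A`: the set `A` of ground terms is a finite disjoint union of languages of
patterns whose non-terminals are among `T, S, N, G_0, …, G_{k-1}`. -/
inductive PatLang (k : ℕ) : Set (GTerm Empty) → Prop
  | empty : PatLang k ∅
  | union {A B} : PatLang k A → PatLang k B → Disjoint A B → PatLang k (A ∪ B)
  | terms : PatLang k setT
  | subs : PatLang k setS
  | indices : PatLang k setN
  | norm {j} : j < k → PatLang k (setG j)
  | zero : PatLang k {.zero}
  | shift : PatLang k {.shift}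
  | succ {A} : PatLang k A → PatLang k (GTerm.succ '' A)
  | lam {A} : PatLang k A → PatLang k (GTerm.lam '' A)
  | slash {A} : PatLang k A → PatLang k (GTerm.slash '' A)
  | lift {A} : PatLang k A → PatLang k (GTerm.lift '' A)
  | app {A B} : PatLang k A → PatLang k B → PatLang k (Set.image2 GTerm.app A B)
  | clos {A B} : PatLang k A → PatLang k B → PatLang k (Set.image2 GTerm.clos A B)

/-- a family of sets containing `∅` and closed under binary disjoint unions is closed under
finite disjoint unions. -/
theorem biUnion_of_disjoint_union {α ι : Type*} {C : Set α → Prop} (empty : C ∅)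
    (union : ∀ {A B}, C A → C B → Disjoint A B → C (A ∪ B)) (s : Finset ι) (f : ι → Set α)
    (hf : ∀ i ∈ s, C (f i)) (hd : ∀ i ∈ s, ∀ j ∈ s, i ≠ j → Disjoint (f i) (f j)) :
    C (⋃ i ∈ s, f i) := by
  classical
  induction s using Finset.induction_on with
  | empty => simpa using empty
  | insert i s hi ih =>
    rw [Finset.set_biUnion_insert]
    refine union (hf i (by simp)) (ih (fun j hj => hf j (by simp [hj]))
      fun j hj l hl => hd j (by simp [hj]) l (by simp [hl])) ?_
    simp only [Set.disjoint_iUnion_right]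
    intro j hj
    exact hd i (by simp) j (by simp [hj]) (by rintro rfl; exact hi hj)

namespace PatLang

variable {k m : ℕ} {A B : Set (GTerm Empty)}

theorem congr (h : PatLang k A) (hAB : B = A) : PatLang k B := hAB ▸ h

theorem mono (hk : k ≤ m) (h : PatLang k A) : PatLang m A := by
  induction h with
  | empty => exact .empty
  | union _ _ h ih ih' => exact .union ih ih' h
  | terms => exact .terms
  | subs => exact .subs
  | indices => exact .indices
  | norm hj => exact .norm (hj.trans_le hk)
  | zero => exact .zero
  | shift => exact .shift
  | succ _ ih => exact .succ ih
  | lam _ ih => exact .lam ih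
  | slash _ ih => exact .slash ih
  | lift _ ih => exact .lift ih
  | app _ _ ih ih' => exact .app ih ih'
  | clos _ _ ih ih' => exact .clos ih ih'

/-- the preimage of a pattern language under `⇑`. -/
theorem preimage_lift (h : PatLang k A) : PatLang k {x | .lift x ∈ A} := by
  induction h with
  | union _ _ h ih ih' =>
    exact .union ih ih' (Set.disjoint_left.2 fun x hx hx' => Set.disjoint_left.1 h hx hx')
  | subs => exact subs.congr (by ext; simp)
  | lift h => exact h.congr (by ext; simp)
  | _ => exact empty.congr (by ext; simp)

/-- the preimage of a pattern language under the successor of indices. -/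
theorem preimage_succ (h : PatLang k A) : PatLang k {x | .succ x ∈ A} := by
  induction h with
  | union _ _ h ih ih' =>
    exact .union ih ih' (Set.disjoint_left.2 fun x hx hx' => Set.disjoint_left.1 h hx hx')
  | terms => exact indices.congr (by ext; simp)
  | indices => exact indices.congr (by ext; simp)
  | @norm j _ =>
    by_cases hj : j = 0
    · exact indices.congr (by ext; simp [hj])
    · exact empty.congr (by ext; simp [hj])
  | succ h => exact h.congr (by ext; simp)
  | _ => exact empty.congr (by ext; simp)

/-- intersections of the languages of the non-terminals with a pattern language. -/
theorem inter_var {K i m : ℕ} (hi : i ≤ K) (hm : m ≤ K)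
    (hD : ∀ j < i, ∀ B, PatLang m B → PatLang K (setD j ∩ B)) (hB : PatLang m B) :
    PatLang K (setT ∩ B) ∧ PatLang K (setS ∩ B) ∧ PatLang K (setN ∩ B) ∧
      ∀ j < i, PatLang K (setG j ∩ B) := by
  induction hB with
  | empty => simp [PatLang.empty]
  | @union B B' _ _ h ih ih' =>
    simp only [Set.inter_union_distrib_left]
    have hd : ∀ X : Set (GTerm Empty), Disjoint (X ∩ B) (X ∩ B') := fun X =>
      h.mono Set.inter_subset_right Set.inter_subset_right
    exact ⟨.union ih.1 ih'.1 (hd _), .union ih.2.1 ih'.2.1 (hd _),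
      .union ih.2.2.1 ih'.2.2.1 (hd _),
      fun j hj => .union (ih.2.2.2 j hj) (ih'.2.2.2 j hj) (hd _)⟩
  | terms =>
    refine ⟨terms.congr (by simp), empty.congr ?_,
      indices.congr (Set.inter_eq_left.2 setN_subset_setT),
      fun j hj => (norm (hj.trans_le hi)).congr
        (Set.inter_eq_left.2 (setG_subset_setT j))⟩
    ext x
    simpa using fun hx hx' => not_mem_setS_of_mem_setT hx' hx
  | subs =>
    refine ⟨empty.congr ?_, subs.congr (by simp), empty.congr ?_,
      fun j _ => empty.congr ?_⟩ <;> ext x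
    · simpa using fun hx => not_mem_setS_of_mem_setT hx
    · simpa using fun hx => not_mem_setS_of_mem_setT (setN_subset_setT hx)
    · simpa using fun hx => not_mem_setS_of_mem_setT (setG_subset_setT j hx)
  | indices =>
    refine ⟨indices.congr (Set.inter_eq_right.2 setN_subset_setT), empty.congr ?_,
      indices.congr (by simp), fun j _ => ?_⟩
    · ext x
      simpa using fun hx hx' => not_mem_setS_of_mem_setT (setN_subset_setT hx') hx
    · by_cases hj : j = 0
      · subst hj
        exact indices.congr (Set.inter_eq_right.2 setN_subset_setG_zero)
      · refine empty.congr ?_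
        ext x
        simpa using fun hx hx' => hj (eq_of_mem_setG hx (setN_subset_setG_zero hx'))
  | @norm l hl =>
    refine ⟨(norm (hl.trans_le hm)).congr (Set.inter_eq_right.2 (setG_subset_setT l)),
      empty.congr ?_, ?_, fun j hj => ?_⟩
    · ext x
      simpa using fun hx hx' => not_mem_setS_of_mem_setT (setG_subset_setT l hx') hx
    · by_cases hl0 : l = 0
      · subst hl0
        exact indices.congr (Set.inter_eq_left.2 setN_subset_setG_zero)
      · refine empty.congr ?_
        ext x
        simpa using fun hx hx' => hl0 (eq_of_mem_setG hx' (setN_subset_setG_zero hx))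
    · by_cases hjl : j = l
      · subst hjl
        exact (norm (hj.trans_le hi)).congr (by simp)
      · refine empty.congr ?_
        ext x
        simpa using fun hx hx' => hjl (eq_of_mem_setG hx hx')
  | zero =>
    refine ⟨zero.congr ?_, empty.congr ?_, zero.congr ?_, fun j _ => ?_⟩
    · ext x; cases x using GTerm.ground_cases <;> simp
    · ext x; cases x using GTerm.ground_cases <;> simp
    · ext x; cases x using GTerm.ground_cases <;> simp
    · by_cases hj : j = 0
      · refine zero.congr ?_
        ext x; cases x using GTerm.ground_cases <;> simp [hj]
      · refine empty.congr ?_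
        ext x; cases x using GTerm.ground_cases <;> simp [hj]
  | shift =>
    refine ⟨empty.congr ?_, shift.congr ?_, empty.congr ?_, fun j _ => empty.congr ?_⟩ <;>
      ext x <;> cases x using GTerm.ground_cases <;> simp
  | @succ B _ ih =>
    refine ⟨(succ ih.2.2.1).congr ?_, empty.congr ?_, (succ ih.2.2.1).congr ?_,
      fun j _ => ?_⟩
    · ext x; cases x using GTerm.ground_cases <;> simp
    · ext x; cases x using GTerm.ground_cases <;> simp
    · ext x; cases x using GTerm.ground_cases <;> simp
    · by_cases hj : j = 0
      · refine (succ ih.2.2.1).congr ?_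
        ext x; cases x using GTerm.ground_cases <;> simp [hj]
      · refine empty.congr ?_
        ext x; cases x using GTerm.ground_cases <;> simp [hj]
  | @lam B _ ih =>
    refine ⟨(lam ih.1).congr ?_, empty.congr ?_, empty.congr ?_,
      fun j hj => (lam (ih.2.2.2 j hj)).congr ?_⟩ <;>
      ext x <;> cases x using GTerm.ground_cases <;> simp
  | @slash B _ ih =>
    refine ⟨empty.congr ?_, (slash ih.1).congr ?_, empty.congr ?_,
      fun j hj => empty.congr ?_⟩ <;>
      ext x <;> cases x using GTerm.ground_cases <;> simp
  | @lift B _ ih =>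
    refine ⟨empty.congr ?_, (lift ih.2.1).congr ?_, empty.congr ?_,
      fun j hj => empty.congr ?_⟩ <;>
      ext x <;> cases x using GTerm.ground_cases <;> simp
  | @app B C _ _ ih ih' =>
    refine ⟨(app ih.1 ih'.1).congr ?_, empty.congr ?_, empty.congr ?_, fun j hj => ?_⟩
    · ext x; cases x using GTerm.ground_cases <;> simp [and_and_and_comm]
    · ext x; cases x using GTerm.ground_cases <;> simp
    · ext x; cases x using GTerm.ground_cases <;> simp
    · have key := biUnion_of_disjoint_union (C := PatLang K) .empty .union
        (Finset.HasAntidiagonal.antidiagonal j)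
        (fun p : ℕ × ℕ => Set.image2 GTerm.app (setG p.1 ∩ B) (setG p.2 ∩ C)) ?_ ?_
      · refine key.congr ?_
        ext x
        cases x using GTerm.ground_cases
        case app x y =>
          simp only [Set.mem_inter_iff, app_mem_setG, app_mem_image2, Set.mem_iUnion,
            Finset.HasAntidiagonal.mem_antidiagonal, exists_prop, Prod.exists]
          constructor
          · rintro ⟨⟨p, q, h, hp, hq⟩, hB, hC⟩
            exact ⟨p, q, h, ⟨hp, hB⟩, hq, hC⟩
          · rintro ⟨p, q, h, ⟨hp, hB⟩, hq, hC⟩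
            exact ⟨⟨p, q, h, hp, hq⟩, hB, hC⟩
        all_goals simp
      · rintro ⟨p, q⟩ h
        rw [Finset.HasAntidiagonal.mem_antidiagonal] at h
        simp only at h
        exact app (ih.2.2.2 p (by omega)) (ih'.2.2.2 q (by omega))
      · rintro ⟨p, q⟩ _ ⟨p', q'⟩ _ hne
        rw [Set.disjoint_left]
        intro x
        cases x using GTerm.ground_cases <;> simp
        intro hp _ hq _ hp' _ hq'
        exact absurd (Prod.ext (eq_of_mem_setG hp hp') (eq_of_mem_setG hq hq')) hne
  | @clos B C hB hC ih ih' =>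
    refine ⟨(clos ih.1 ih'.2.1).congr ?_, empty.congr ?_, empty.congr ?_,
      fun j hj => (hD j hj _ (clos hB hC)).congr ?_⟩
    · ext x; cases x using GTerm.ground_cases <;> simp [and_and_and_comm]
    · ext x; cases x using GTerm.ground_cases <;> simp
    · ext x; cases x using GTerm.ground_cases <;> simp
    · ext x; cases x using GTerm.ground_cases <;> simp

/-- to intersect `A` with every pattern language it is enough to intersect it with
non-terminals and with constructor images. -/
theorem inter_cases {K m : ℕ} (var : PatLang K (setT ∩ A) ∧ PatLang K (setS ∩ A) ∧
      PatLang K (setN ∩ A) ∧ ∀ j < m, PatLang K (setG j ∩ A))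
    (hzero : PatLang K (A ∩ {.zero})) (hshift : PatLang K (A ∩ {.shift}))
    (succ : ∀ B, PatLang m B → PatLang K (A ∩ GTerm.succ '' B))
    (lam : ∀ B, PatLang m B → PatLang K (A ∩ GTerm.lam '' B))
    (slash : ∀ B, PatLang m B → PatLang K (A ∩ GTerm.slash '' B))
    (lift : ∀ B, PatLang m B → PatLang K (A ∩ GTerm.lift '' B))
    (app : ∀ B C, PatLang m B → PatLang m C → PatLang K (A ∩ Set.image2 GTerm.app B C))
    (clos : ∀ B C, PatLang m B → PatLang m C → PatLang K (A ∩ Set.image2 GTerm.clos B C))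
    (hB : PatLang m B) : PatLang K (A ∩ B) := by
  induction hB with
  | empty => simp [PatLang.empty]
  | union _ _ h ih ih' =>
    rw [Set.inter_union_distrib_left]
    exact .union ih ih' (h.mono Set.inter_subset_right Set.inter_subset_right)
  | terms => exact var.1.congr (Set.inter_comm _ _)
  | subs => exact var.2.1.congr (Set.inter_comm _ _)
  | indices => exact var.2.2.1.congr (Set.inter_comm _ _)
  | norm hj => exact (var.2.2.2 _ hj).congr (Set.inter_comm _ _)
  | zero => exact hzero
  | shift => exact hshift
  | succ h => exact succ _ h
  | lam h => exact lam _ h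
  | slash h => exact slash _ h
  | lift h => exact lift _ h
  | app h h' => exact app _ _ h h'
  | clos h h' => exact clos _ _ h h'

theorem inter_aux {K : ℕ} (hD : ∀ j < K, PatLang j (setD j)) (s : ℕ) :
    ∀ i m : ℕ, i + m = s → i ≤ K → m ≤ K → ∀ A B, PatLang i A → PatLang m B →
      PatLang K (A ∩ B) := by
  induction s using Nat.strong_induction_on with
  | _ s IH =>
    intro i m hs hi hm A B hA hB
    have left {B} (hB : PatLang m B) := inter_var hi hm
      (fun j hj B hB => IH (j + m) (by omega) j m rfl (by omega) hm _ _
        (hD j (by omega)) hB) hB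
    have right {A} (hA : PatLang i A) := inter_var hm hi
      (fun j hj A hA => (IH (i + j) (by omega) i j rfl hi (by omega) _ _
        hA (hD j (by omega))).congr (Set.inter_comm _ _)) hA
    induction hA generalizing B with
    | empty => simp [PatLang.empty]
    | @union A A' _ _ h ih ih' =>
      rw [Set.union_inter_distrib_right]
      exact .union (ih B hB) (ih' B hB) (h.mono Set.inter_subset_left Set.inter_subset_left)
    | terms => exact (left hB).1
    | subs => exact (left hB).2.1
    | indices => exact (left hB).2.2.1
    | norm hj => exact (left hB).2.2.2 _ hj
    | zero =>
      refine inter_cases (right .zero) ?same_zero ?_ ?_ ?_ ?_ ?_ ?_ ?_ hB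
      case same_zero => exact zero.congr (by simp)
      all_goals
        intros
        refine empty.congr ?_
        ext x; cases x using GTerm.ground_cases <;> simp
    | shift =>
      refine inter_cases (right .shift) ?_ ?same_shift ?_ ?_ ?_ ?_ ?_ ?_ hB
      case same_shift => exact shift.congr (by simp)
      all_goals
        intros
        refine empty.congr ?_
        ext x; cases x using GTerm.ground_cases <;> simp
    | succ hA ih =>
      refine inter_cases (right (.succ hA)) ?_ ?_ ?same_succ ?_ ?_ ?_ ?_ ?_ hB
      case same_succ =>
        refine fun B hB => (succ (ih B hB)).congr ?_
        ext x; cases x using GTerm.ground_cases <;> simp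
      all_goals
        intros
        refine empty.congr ?_
        ext x; cases x using GTerm.ground_cases <;> simp
    | lam hA ih =>
      refine inter_cases (right (.lam hA)) ?_ ?_ ?_ ?same_lam ?_ ?_ ?_ ?_ hB
      case same_lam =>
        refine fun B hB => (lam (ih B hB)).congr ?_
        ext x; cases x using GTerm.ground_cases <;> simp
      all_goals
        intros
        refine empty.congr ?_
        ext x; cases x using GTerm.ground_cases <;> simp
    | slash hA ih =>
      refine inter_cases (right (.slash hA)) ?_ ?_ ?_ ?_ ?same_slash ?_ ?_ ?_ hB
      case same_slash =>
        refine fun B hB => (slash (ih B hB)).congr ?_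
        ext x; cases x using GTerm.ground_cases <;> simp
      all_goals
        intros
        refine empty.congr ?_
        ext x; cases x using GTerm.ground_cases <;> simp
    | lift hA ih =>
      refine inter_cases (right (.lift hA)) ?_ ?_ ?_ ?_ ?_ ?same_lift ?_ ?_ hB
      case same_lift =>
        refine fun B hB => (lift (ih B hB)).congr ?_
        ext x; cases x using GTerm.ground_cases <;> simp
      all_goals
        intros
        refine empty.congr ?_
        ext x; cases x using GTerm.ground_cases <;> simp
    | app hA hA' ih ih' =>
      refine inter_cases (right (.app hA hA')) ?_ ?_ ?_ ?_ ?_ ?_ ?same_app ?_ hB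
      case same_app =>
        refine fun B C hB hC => (app (ih B hB) (ih' C hC)).congr ?_
        ext x; cases x using GTerm.ground_cases <;> simp [and_and_and_comm]
      all_goals
        intros
        refine empty.congr ?_
        ext x; cases x using GTerm.ground_cases <;> simp
    | clos hA hA' ih ih' =>
      refine inter_cases (right (.clos hA hA')) ?_ ?_ ?_ ?_ ?_ ?_ ?_ ?same_clos hB
      case same_clos =>
        refine fun B C hB hC => (clos (ih B hB) (ih' C hC)).congr ?_
        ext x; cases x using GTerm.ground_cases <;> simp [and_and_and_comm]
      all_goals
        intros
        refine empty.congr ?_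
        ext x; cases x using GTerm.ground_cases <;> simp

theorem inter (hD : ∀ j < k, PatLang j (setD j)) (hA : PatLang k A) (hB : PatLang k B) :
    PatLang k (A ∩ B) :=
  inter_aux hD (k + k) k k rfl le_rfl le_rfl A B hA hB

end PatLang

/-! ## Pattern languages of terms, substitutions and iterated closures -/

/-- the encodings of `A` form a pattern language. -/
def TermLang (k : ℕ) (A : Set LTerm) : Prop := PatLang k (encT '' A)

/-- the encodings of `A` form a pattern language. -/
def SubLang (k : ℕ) (A : Set LSub) : Prop := PatLang k (encS '' A)

/-- finite disjoint unions of products of pattern languages of substitutions. -/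
inductive SubsLang (k : ℕ) : Set (List LSub) → Prop
  | empty : SubsLang k ∅
  | union {A B} : SubsLang k A → SubsLang k B → Disjoint A B → SubsLang k (A ∪ B)
  | nil : SubsLang k {[]}
  | cons {a A} : SubLang k a → SubsLang k A → SubsLang k (Set.image2 List.cons a A)

/-- finite disjoint unions of products of a pattern language of terms with pattern languages
of substitutions; a pair `(a, [σ₁, …, σ_w])` stands for `a[σ₁]⋯[σ_w]`. -/
inductive HeadLang (k : ℕ) : Set (LTerm × List LSub) → Prop
  | empty : HeadLang k ∅
  | union {A B} : HeadLang k A → HeadLang k B → Disjoint A B → HeadLang k (A ∪ B)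
  | prod {a A} : TermLang k a → SubsLang k A → HeadLang k (a ×ˢ A)

namespace TermLang

variable {k m : ℕ} {A B : Set LTerm}

theorem congr (h : TermLang k A) (hAB : B = A) : TermLang k B := hAB ▸ h

theorem empty : TermLang k ∅ := PatLang.empty.congr (by simp)

theorem mono (hk : k ≤ m) (h : TermLang k A) : TermLang m A := PatLang.mono hk h

theorem union (hA : TermLang k A) (hB : TermLang k B) (h : Disjoint A B) :
    TermLang k (A ∪ B) := by
  unfold TermLang
  rw [Set.image_union]
  exact PatLang.union hA hB ((Set.disjoint_image_iff fun _ _ => encT_injective).2 h)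

theorem univ : TermLang k Set.univ := PatLang.terms.congr Set.image_univ

theorem norm {j : ℕ} (hj : j < k) : TermLang k {t | NormIn t j} := PatLang.norm hj

theorem lam (hA : TermLang k A) : TermLang k (LTerm.lam '' A) :=
  (PatLang.lam hA).congr (by simp [Set.image_image, encT])

theorem app (hA : TermLang k A) (hB : TermLang k B) :
    TermLang k (Set.image2 LTerm.app A B) :=
  (PatLang.app hA hB).congr (by simp [Set.image_image2, Set.image2_image_left,
    Set.image2_image_right, encT])

theorem clos {B : Set LSub} (hA : TermLang k A) (hB : SubLang k B) :
    TermLang k (Set.image2 LTerm.clos A B) :=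
  (PatLang.clos hA hB).congr (by simp [Set.image_image2, Set.image2_image_left,
    Set.image2_image_right, encT])

theorem idx_zero : TermLang k {.idx 0} := PatLang.zero.congr (by simp [encT, encIdx])

theorem idx_pred (hA : TermLang k A) : TermLang k {t | ∃ m, t = .idx m ∧ .idx (m + 1) ∈ A} := by
  refine (PatLang.preimage_succ hA).congr ?_
  ext x
  constructor
  · rintro ⟨_, ⟨m, rfl, hm⟩, rfl⟩
    exact ⟨_, hm, rfl⟩
  · rintro ⟨t, ht, h⟩
    cases t with
    | idx m =>
      cases m with
      | zero => simp [encT, encIdx] at h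
      | succ m => exact ⟨_, ⟨m, rfl, ht⟩, by simpa [encT, encIdx] using h⟩
    | _ => simp [encT] at h

theorem idx_succ (hD : ∀ j < k, PatLang j (setD j)) (hA : TermLang k A) :
    TermLang k {t | ∃ m, t = .idx (m + 1) ∧ .idx m ∈ A} := by
  refine (PatLang.inter hD .indices hA).succ.congr ?_
  ext x
  constructor
  · rintro ⟨_, ⟨m, rfl, hm⟩, rfl⟩
    exact ⟨encIdx m, ⟨⟨m, rfl⟩, _, hm, rfl⟩, rfl⟩
  · rintro ⟨_, ⟨⟨m, rfl⟩, t, ht, h⟩, rfl⟩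
    obtain rfl : t = .idx m := encT_injective h
    exact ⟨_, ⟨m, rfl, ht⟩, rfl⟩

end TermLang

namespace SubLang

variable {k m : ℕ} {A B : Set LSub}

theorem empty : SubLang k ∅ := PatLang.empty.congr (by simp)

theorem mono (hk : k ≤ m) (h : SubLang k A) : SubLang m A := PatLang.mono hk h

theorem union (hA : SubLang k A) (hB : SubLang k B) (h : Disjoint A B) :
    SubLang k (A ∪ B) := by
  unfold SubLang
  rw [Set.image_union]
  exact PatLang.union hA hB ((Set.disjoint_image_iff fun _ _ => encS_injective).2 h)

theorem univ : SubLang k Set.univ := PatLang.subs.congr Set.image_univ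

theorem shift : SubLang k {.shift} := PatLang.shift.congr (by simp [encS])

theorem slash {A : Set LTerm} (hA : TermLang k A) : SubLang k (LSub.slash '' A) :=
  (PatLang.slash hA).congr (by simp [Set.image_image, encS])

theorem lift (hA : SubLang k A) : SubLang k (LSub.lift '' A) :=
  (PatLang.lift hA).congr (by simp [Set.image_image, encS])

theorem preimage_lift (hA : SubLang k A) : SubLang k {s | .lift s ∈ A} := by
  refine (PatLang.preimage_lift hA).congr ?_
  ext x
  constructor
  · rintro ⟨s, hs, rfl⟩
    exact ⟨_, hs, rfl⟩
  · rintro ⟨s, hs, h⟩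
    cases s with
    | lift s => exact ⟨s, hs, by simpa [encS] using h⟩
    | _ => simp [encS] at h

theorem inter (hD : ∀ j < k, PatLang j (setD j)) (hA : SubLang k A) (hB : SubLang k B) :
    SubLang k (A ∩ B) :=
  (PatLang.inter hD hA hB).congr (Set.image_inter fun _ _ => encS_injective)

end SubLang

namespace SubsLang

variable {k m : ℕ} {A B : Set (List LSub)}

theorem congr (h : SubsLang k A) (hAB : B = A) : SubsLang k B := hAB ▸ h

theorem mono (hk : k ≤ m) (h : SubsLang k A) : SubsLang m A := by
  induction h with
  | empty => exact .empty
  | union _ _ h ih ih' => exact .union ih ih' h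
  | nil => exact .nil
  | cons ha _ ih => exact .cons (ha.mono hk) ih

/-- inverse images of `SubsLang` along a partial function, given as a relation `R`. -/
theorem pull {β : Type*} {C : Set β → Prop} (empty : C ∅)
    (union : ∀ {A B}, C A → C B → Disjoint A B → C (A ∪ B)) {R : β → List LSub → Prop}
    (hR : ∀ p l l', R p l → R p l' → l = l') (nil : C {p | R p []})
    (cons : ∀ a A, SubLang k a → SubsLang k A → C {p | ∃ l ∈ A, R p l} →
      C {p | ∃ s ∈ a, ∃ l ∈ A, R p (s :: l)})
    (h : SubsLang k A) : C {p | ∃ l ∈ A, R p l} := by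
  induction h with
  | empty => simpa using empty
  | @union A B _ _ h ih ih' =>
    have key := union ih ih' (Set.disjoint_left.2 fun p ⟨l, hl, hp⟩ ⟨l', hl', hp'⟩ =>
      Set.disjoint_left.1 h hl (hR p l l' hp hp' ▸ hl'))
    convert key using 1
    ext p
    simp [or_and_right, exists_or]
  | nil => simpa using nil
  | cons ha hA ih =>
    convert cons _ _ ha hA ih using 1
    ext p
    simp [Set.mem_image2]

theorem map_lift (h : SubsLang k A) : SubsLang k {l | l.map .lift ∈ A} := by
  have key := h.pull (C := SubsLang k) .empty .union (R := fun p l => p.map .lift = l)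
    (fun _ _ _ h h' => h.symm.trans h') (nil.congr (by ext; simp)) ?_
  · exact key.congr (by ext; simp)
  · intro a A ha _ ih
    refine (cons ha.preimage_lift ih).congr ?_
    ext p
    cases p <;> simp [Set.mem_image2]

theorem tail (s : LSub) (h : SubsLang k A) : SubsLang k {l | s :: l ∈ A} := by
  have key := h.pull (C := SubsLang k) .empty .union (R := fun p l => s :: p = l)
    (fun _ _ _ h h' => h.symm.trans h') (empty.congr (by ext; simp)) ?_
  · exact key.congr (by ext; simp)
  · intro a A _ hA _
    by_cases hs : s ∈ a
    · exact hA.congr (by ext; simp [hs])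
    · exact empty.congr (by ext; simp [hs])

theorem lift_head (h : SubsLang k A) :
    SubsLang k {l | ∃ s r, l = .lift s :: r ∧ s :: .shift :: r ∈ A} := by
  have key := h.pull (C := SubsLang k) .empty .union
    (R := fun p l => ∃ s r, p = .lift s :: r ∧ s :: .shift :: r = l)
    (by rintro _ _ _ ⟨s, r, rfl, rfl⟩ ⟨s', r', h, rfl⟩; simpa using h)
    (empty.congr (by ext; simp)) ?_
  · refine key.congr ?_
    ext p
    constructor
    · rintro ⟨s, r, rfl, h⟩
      exact ⟨_, h, s, r, rfl, rfl⟩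
    · rintro ⟨_, h, s, r, rfl, rfl⟩
      exact ⟨s, r, rfl, h⟩
  · intro a A ha hA _
    refine (cons ha.lift (hA.tail .shift)).congr ?_
    ext p
    constructor
    · rintro ⟨s, hs, l, hl, s', r, rfl, h⟩
      simp only [List.cons.injEq] at h
      obtain ⟨rfl, rfl⟩ := h
      exact ⟨_, ⟨_, hs, rfl⟩, _, hl, rfl⟩
    · rintro ⟨_, ⟨s, hs, rfl⟩, r, hr, rfl⟩
      exact ⟨s, hs, _, hr, s, r, rfl, rfl⟩

/-- the substitutions `σ` with `[σ] ∈ A`. -/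
theorem singleton (h : SubsLang k A) : SubLang k {s | [s] ∈ A} := by
  have key := h.pull (C := SubLang k) .empty .union (R := fun s l => [s] = l)
    (fun _ _ _ h h' => h.symm.trans h') (by simpa using SubLang.empty) ?_
  · simpa using key
  · intro a A ha _ _
    by_cases hs : [] ∈ A
    · simpa [hs] using ha
    · simpa [hs] using SubLang.empty

theorem inter (hD : ∀ j < k, PatLang j (setD j)) (hA : SubsLang k A) (hB : SubsLang k B) :
    SubsLang k (A ∩ B) := by
  induction hA generalizing B with
  | empty => simpa using empty
  | union _ _ h ih ih' =>
    rw [Set.union_inter_distrib_right]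
    exact union (ih hB) (ih' hB) (h.mono Set.inter_subset_left Set.inter_subset_left)
  | nil =>
    by_cases h : [] ∈ B
    · exact nil.congr (by simpa using h)
    · exact empty.congr (by simpa using h)
  | @cons a A ha _ ih =>
    have key := hB.pull (C := SubsLang k) .empty .union
      (R := fun p l => p ∈ Set.image2 List.cons a A ∧ p = l)
      (fun _ _ _ h h' => h.2.symm.trans h'.2) (empty.congr (by ext; simp; aesop)) ?_
    · refine key.congr ?_
      ext p
      simp
      tauto
    · intro b B hb hB _
      refine (cons (ha.inter hD hb) (ih hB)).congr ?_
      ext p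
      constructor
      · rintro ⟨s, hs, l, hl, ⟨s', hs', l', hl', rfl⟩, h⟩
        simp only [List.cons.injEq] at h
        obtain ⟨rfl, rfl⟩ := h
        exact ⟨_, ⟨hs', hs⟩, _, ⟨hl', hl⟩, rfl⟩
      · rintro ⟨s, ⟨hs, hs'⟩, l, ⟨hl, hl'⟩, rfl⟩
        exact ⟨s, hs', l, hl', ⟨s, hs, l, hl, rfl⟩, rfl⟩

end SubsLang

namespace HeadLang

variable {k m : ℕ} {A B : Set (LTerm × List LSub)}

theorem congr (h : HeadLang k A) (hAB : B = A) : HeadLang k B := hAB ▸ h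

theorem mono (hk : k ≤ m) (h : HeadLang k A) : HeadLang m A := by
  induction h with
  | empty => exact .empty
  | union _ _ h ih ih' => exact .union ih ih' h
  | prod ha hA => exact .prod (ha.mono hk) (hA.mono hk)

/-- inverse images of `HeadLang` along a partial function, given as a relation `R`. -/
theorem pull {β : Type*} {C : Set β → Prop} (empty : C ∅)
    (union : ∀ {A B}, C A → C B → Disjoint A B → C (A ∪ B))
    (R : β → LTerm × List LSub → Prop) (hR : ∀ p q q', R p q → R p q' → q = q')
    (prod : ∀ a A, TermLang k a → SubsLang k A → C {p | ∃ q ∈ a ×ˢ A, R p q})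
    (h : HeadLang k A) : C {p | ∃ q ∈ A, R p q} := by
  induction h with
  | empty => simpa using empty
  | @union A B _ _ h ih ih' =>
    have key := union ih ih' (Set.disjoint_left.2 fun p ⟨l, hl, hp⟩ ⟨l', hl', hp'⟩ =>
      Set.disjoint_left.1 h hl (hR p l l' hp hp' ▸ hl'))
    convert key using 1
    ext p
    simp only [Set.mem_union, Set.mem_ofPred_eq, or_and_right, exists_or]
  | prod ha hA => exact prod _ _ ha hA

theorem clos_pop (h : HeadLang k A) :
    HeadLang k {p | ∃ t s l, p = (.clos t s, l) ∧ (t, s :: l) ∈ A} := by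
  have key := h.pull (C := HeadLang k) .empty .union
    (fun p q => ∃ t s l, p = (.clos t s, l) ∧ (t, s :: l) = q)
    (by
      rintro _ _ _ ⟨t, s, l, rfl, rfl⟩ ⟨t', s', l', h, rfl⟩
      simp only [Prod.mk.injEq, LTerm.clos.injEq] at h
      obtain ⟨⟨rfl, rfl⟩, rfl⟩ := h
      rfl) ?_
  · refine key.congr ?_
    ext p
    constructor
    · rintro ⟨t, s, l, rfl, h⟩
      exact ⟨_, h, t, s, l, rfl, rfl⟩
    · rintro ⟨_, h, t, s, l, rfl, rfl⟩
      exact ⟨t, s, l, rfl, h⟩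
  · intro a A ha hA
    have key := hA.pull (C := HeadLang k) .empty .union
      (R := fun p l => ∃ t ∈ a, ∃ s r, p = (.clos t s, r) ∧ s :: r = l)
      (by
        rintro _ _ _ ⟨t, _, s, l, rfl, rfl⟩ ⟨t', _, s', l', h, rfl⟩
        simp only [Prod.mk.injEq, LTerm.clos.injEq] at h
        obtain ⟨⟨rfl, rfl⟩, rfl⟩ := h
        rfl) (empty.congr (by ext; simp)) ?_
    · refine key.congr ?_
      ext p
      constructor
      · rintro ⟨⟨t, l⟩, ⟨ht, hl⟩, _, s, r, rfl, h⟩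
        simp only [Prod.mk.injEq] at h
        obtain ⟨rfl, rfl⟩ := h
        exact ⟨_, hl, _, ht, s, r, rfl, rfl⟩
      · rintro ⟨_, hl, t, ht, s, r, rfl, rfl⟩
        exact ⟨(t, s :: r), ⟨ht, hl⟩, _, s, r, rfl, rfl⟩
    · intro b B hb hB _
      refine (prod (ha.clos hb) hB).congr ?_
      ext p
      constructor
      · rintro ⟨s, hs, l, hl, t, ht, s', r, rfl, h⟩
        simp only [List.cons.injEq] at h
        obtain ⟨rfl, rfl⟩ := h
        exact ⟨⟨t, ht, _, hs, rfl⟩, hl⟩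
      · obtain ⟨p, l⟩ := p
        rintro ⟨⟨t, ht, s, hs, rfl⟩, hl⟩
        exact ⟨s, hs, l, hl, t, ht, s, l, rfl, rfl⟩

/-- inverse images along a relation of the form `(f t, g l) ↦ (t, l)`, up to the constraints
given by `R` and `R'`. -/
theorem comap (h : HeadLang k A) (R : LTerm → LTerm → Prop)
    (R' : List LSub → List LSub → Prop) (hR : ∀ t u v, R t u → R t v → u = v)
    (hR' : ∀ t u v, R' t u → R' t v → u = v)
    (hT : ∀ a, TermLang k a → TermLang k {t | ∃ u ∈ a, R t u})
    (hS : ∀ A, SubsLang k A → SubsLang k {l | ∃ r ∈ A, R' l r}) :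
    HeadLang k {p | ∃ q ∈ A, R p.1 q.1 ∧ R' p.2 q.2} := by
  refine h.pull (C := HeadLang k) .empty .union (fun p q => R p.1 q.1 ∧ R' p.2 q.2)
    (fun p q q' h h' => Prod.ext (hR _ _ _ h.1 h'.1) (hR' _ _ _ h.2 h'.2)) ?_
  intro a A ha hA
  refine (prod (hT a ha) (hS A hA)).congr ?_
  ext ⟨t, l⟩
  constructor
  · rintro ⟨⟨u, r⟩, ⟨hu, hr⟩, h, h'⟩
    exact ⟨⟨u, hu, h⟩, r, hr, h'⟩
  · rintro ⟨⟨u, hu, h⟩, r, hr, h'⟩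
    exact ⟨(u, r), ⟨hu, hr⟩, h, h'⟩

theorem lam (h : HeadLang k A) :
    HeadLang k {p | ∃ a l, p = (.lam a, l) ∧ (a, l.map .lift) ∈ A} := by
  refine (h.comap (fun t u => t = .lam u) (fun l r => l.map .lift = r)
    (by rintro _ _ _ rfl h; simpa using h) (by rintro _ _ _ rfl h; exact h)
    (fun a ha => (TermLang.lam ha).congr ?_) (fun A hA => hA.map_lift.congr ?_)).congr ?_
  · ext
    simp [eq_comm]
  · ext
    simp
  · ext p
    constructor
    · rintro ⟨a, l, rfl, h⟩
      exact ⟨_, h, rfl, rfl⟩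
    · obtain ⟨p, l⟩ := p
      rintro ⟨⟨a, r⟩, h, rfl, h'⟩
      obtain rfl : l.map .lift = r := h'
      exact ⟨a, l, rfl, h⟩

theorem varShift (h : HeadLang k A) :
    HeadLang k {p | ∃ m l, p = (.idx m, .shift :: l) ∧ (.idx (m + 1), l) ∈ A} := by
  refine (h.comap (fun t u => ∃ m, t = .idx m ∧ u = .idx (m + 1)) (fun l r => l = .shift :: r)
    (by rintro _ _ _ ⟨m, rfl, rfl⟩ ⟨n, h, rfl⟩; simpa using h)
    (by rintro _ _ _ rfl h; simpa using h)
    (fun a ha => (TermLang.idx_pred ha).congr ?_)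
    (fun A hA => (SubsLang.cons .shift hA).congr ?_)).congr ?_
  · ext t
    constructor
    · rintro ⟨_, h, m, rfl, rfl⟩
      exact ⟨m, rfl, h⟩
    · rintro ⟨m, rfl, h⟩
      exact ⟨_, h, m, rfl, rfl⟩
  · ext
    simp [eq_comm]
  · ext p
    constructor
    · rintro ⟨m, l, rfl, h⟩
      exact ⟨_, h, ⟨m, rfl, rfl⟩, rfl⟩
    · obtain ⟨p, l⟩ := p
      rintro ⟨⟨a, r⟩, h, ⟨m, rfl, rfl⟩, rfl⟩
      exact ⟨m, r, rfl, h⟩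

theorem rvarLift (hD : ∀ j < k, PatLang j (setD j)) (h : HeadLang k A) :
    HeadLang k {p | ∃ m s l, p = (.idx (m + 1), .lift s :: l) ∧
      (.idx m, s :: .shift :: l) ∈ A} := by
  refine (h.comap (fun t u => ∃ m, t = .idx (m + 1) ∧ u = .idx m)
    (fun l r => ∃ s q, l = .lift s :: q ∧ r = s :: .shift :: q)
    (by rintro _ _ _ ⟨m, rfl, rfl⟩ ⟨n, h, rfl⟩; simpa using h)
    (by rintro _ _ _ ⟨s, q, rfl, rfl⟩ ⟨s', q', h, rfl⟩; simpa using h)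
    (fun a ha => (TermLang.idx_succ hD ha).congr ?_)
    (fun A hA => hA.lift_head.congr ?_)).congr ?_
  · ext t
    constructor
    · rintro ⟨_, h, m, rfl, rfl⟩
      exact ⟨m, rfl, h⟩
    · rintro ⟨m, rfl, h⟩
      exact ⟨_, h, m, rfl, rfl⟩
  · ext t
    constructor
    · rintro ⟨_, h, m, q, rfl, rfl⟩
      exact ⟨m, q, rfl, h⟩
    · rintro ⟨m, q, rfl, h⟩
      exact ⟨_, h, m, q, rfl, rfl⟩
  · ext p
    constructor
    · rintro ⟨m, s, l, rfl, h⟩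
      exact ⟨_, h, ⟨m, rfl, rfl⟩, s, l, rfl, rfl⟩
    · obtain ⟨p, l⟩ := p
      rintro ⟨⟨a, r⟩, h, ⟨m, rfl, rfl⟩, s, l, rfl, rfl⟩
      exact ⟨m, s, l, rfl, h⟩

theorem rvar (hD : ∀ j < k, PatLang j (setD j)) (h : HeadLang k A) :
    HeadLang k {p | ∃ m a l, p = (.idx (m + 1), .slash a :: l) ∧ (.idx m, l) ∈ A} := by
  refine (h.comap (fun t u => ∃ m, t = .idx (m + 1) ∧ u = .idx m)
    (fun l r => ∃ a, l = .slash a :: r)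
    (by rintro _ _ _ ⟨m, rfl, rfl⟩ ⟨n, h, rfl⟩; simpa using h)
    (by rintro _ _ _ ⟨s, rfl⟩ ⟨s', h⟩; exact (List.cons.inj h).2)
    (fun a ha => (TermLang.idx_succ hD ha).congr ?_)
    (fun A hA => (SubsLang.cons (.slash .univ) hA).congr ?_)).congr ?_
  · ext t
    constructor
    · rintro ⟨_, h, m, rfl, rfl⟩
      exact ⟨m, rfl, h⟩
    · rintro ⟨m, rfl, h⟩
      exact ⟨_, h, m, rfl, rfl⟩
  · ext t
    constructor
    · rintro ⟨r, h, a, rfl⟩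
      exact ⟨_, ⟨a, trivial, rfl⟩, r, h, rfl⟩
    · rintro ⟨_, ⟨a, -, rfl⟩, r, h, rfl⟩
      exact ⟨r, h, a, rfl⟩
  · ext p
    constructor
    · rintro ⟨m, s, l, rfl, h⟩
      exact ⟨_, h, ⟨m, rfl, rfl⟩, s, rfl⟩
    · obtain ⟨p, l⟩ := p
      rintro ⟨⟨a, r⟩, h, ⟨m, rfl, rfl⟩, s, rfl⟩
      exact ⟨m, s, r, rfl, h⟩

theorem fvarLift (h : HeadLang k A) :
    HeadLang k {p | ∃ s l, p = (.idx 0, .lift s :: l) ∧ (.idx 0, l) ∈ A} := by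
  refine (h.comap (fun t u => t = .idx 0 ∧ u = .idx 0) (fun l r => ∃ s, l = .lift s :: r)
    (by rintro _ _ _ ⟨rfl, rfl⟩ ⟨-, rfl⟩; rfl)
    (by rintro _ _ _ ⟨s, rfl⟩ ⟨s', h⟩; exact (List.cons.inj h).2)
    (fun a ha => ?_)
    (fun A hA => (SubsLang.cons (.lift .univ) hA).congr ?_)).congr ?_
  · by_cases h : .idx 0 ∈ a
    · convert TermLang.idx_zero using 1
      ext t
      simp [h]
    · convert TermLang.empty using 1
      ext t
      simp [h]
  · ext t
    constructor
    · rintro ⟨r, h, a, rfl⟩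
      exact ⟨_, ⟨a, trivial, rfl⟩, r, h, rfl⟩
    · rintro ⟨_, ⟨a, -, rfl⟩, r, h, rfl⟩
      exact ⟨r, h, a, rfl⟩
  · ext p
    constructor
    · rintro ⟨s, l, rfl, h⟩
      exact ⟨_, h, ⟨rfl, rfl⟩, s, rfl⟩
    · obtain ⟨p, l⟩ := p
      rintro ⟨⟨a, r⟩, h, ⟨rfl, rfl⟩, s, rfl⟩
      exact ⟨s, r, rfl, h⟩

theorem fvar (h : HeadLang k A) :
    HeadLang k {p | ∃ a l, p = (.idx 0, .slash a :: l) ∧ (a, l) ∈ A} := by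
  have key := h.pull (C := HeadLang k) .empty .union
    (fun p q => p = (.idx 0, .slash q.1 :: q.2))
    (by
      rintro _ ⟨a, l⟩ ⟨a', l'⟩ rfl h
      simpa using h) ?_
  · refine key.congr ?_
    ext p
    constructor
    · rintro ⟨a, l, rfl, h⟩
      exact ⟨_, h, rfl⟩
    · rintro ⟨⟨a, l⟩, h, rfl⟩
      exact ⟨a, l, rfl, h⟩
  · intro a A ha hA
    refine (prod .idx_zero (.cons (SubLang.slash ha) hA)).congr ?_
    ext p
    constructor
    · rintro ⟨⟨t, l⟩, ⟨ht, hl⟩, rfl⟩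
      exact ⟨rfl, _, ⟨t, ht, rfl⟩, l, hl, rfl⟩
    · obtain ⟨p, q⟩ := p
      rintro ⟨rfl, _, ⟨t, ht, rfl⟩, l, hl, rfl⟩
      exact ⟨(t, l), ⟨ht, hl⟩, rfl⟩

theorem app (hD : ∀ j < k, PatLang j (setD j)) (hA : HeadLang k A) (hB : HeadLang k B) :
    HeadLang k {p | ∃ a b l, p = (.app a b, l) ∧ (a, l) ∈ A ∧ (b, l) ∈ B} := by
  have key := hA.pull (C := HeadLang k) .empty .union
    (fun p q => ∃ a b l, p = (.app a b, l) ∧ (b, l) ∈ B ∧ (a, l) = q)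
    (by
      rintro _ _ _ ⟨a, b, l, rfl, _, rfl⟩ ⟨a', b', l', h, _, rfl⟩
      simp only [Prod.mk.injEq, LTerm.app.injEq] at h
      obtain ⟨⟨rfl, rfl⟩, rfl⟩ := h
      rfl) ?_
  · refine key.congr ?_
    ext p
    constructor
    · rintro ⟨a, b, l, rfl, h, h'⟩
      exact ⟨_, h, a, b, l, rfl, h', rfl⟩
    · rintro ⟨_, h, a, b, l, rfl, h', rfl⟩
      exact ⟨a, b, l, rfl, h, h'⟩
  · intro a A ha hA
    have key := hB.pull (C := HeadLang k) .empty .union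
      (fun p q => ∃ t ∈ a, ∃ u, ∃ l ∈ A, p = (.app t u, l) ∧ (u, l) = q)
      (by
        rintro _ _ _ ⟨t, _, u, l, _, rfl, rfl⟩ ⟨t', _, u', l', _, h, rfl⟩
        simp only [Prod.mk.injEq, LTerm.app.injEq] at h
        obtain ⟨⟨rfl, rfl⟩, rfl⟩ := h
        rfl) ?_
    · refine key.congr ?_
      ext p
      constructor
      · rintro ⟨_, ⟨h, h'⟩, t, u, l, rfl, hu, rfl⟩
        exact ⟨_, hu, t, h, u, l, h', rfl, rfl⟩
      · rintro ⟨_, hu, t, h, u, l, h', rfl, rfl⟩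
        exact ⟨(t, l), ⟨h, h'⟩, t, u, l, rfl, hu, rfl⟩
    · intro b B hb hB
      refine (prod (ha.app hb) (hA.inter hD hB)).congr ?_
      ext p
      constructor
      · rintro ⟨_, ⟨h, h'⟩, t, ht, u, l, hl, rfl, rfl⟩
        exact ⟨⟨t, ht, u, h, rfl⟩, hl, h'⟩
      · obtain ⟨p, l⟩ := p
        rintro ⟨⟨t, ht, u, hu, rfl⟩, hl, hl'⟩
        exact ⟨(u, l), ⟨hu, hl'⟩, t, ht, u, l, hl, rfl, rfl⟩

theorem termLang_clos (h : HeadLang k A) :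
    TermLang k {t | ∃ a s, t = .clos a s ∧ (a, [s]) ∈ A} := by
  have key := h.pull (C := TermLang k) .empty .union
    (fun t q => ∃ a s, t = .clos a s ∧ (a, [s]) = q)
    (by
      rintro _ _ _ ⟨a, s, rfl, rfl⟩ ⟨a', s', h, rfl⟩
      simp only [LTerm.clos.injEq] at h
      obtain ⟨rfl, rfl⟩ := h
      rfl) ?_
  · convert key using 1
    ext t
    constructor
    · rintro ⟨a, s, rfl, h⟩
      exact ⟨_, h, a, s, rfl, rfl⟩
    · rintro ⟨_, h, a, s, rfl, rfl⟩
      exact ⟨a, s, rfl, h⟩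
  · intro a A ha hA
    convert ha.clos hA.singleton using 1
    ext t
    constructor
    · rintro ⟨_, ⟨h, h'⟩, t, s, rfl, rfl⟩
      exact ⟨t, h, s, h', rfl⟩
    · rintro ⟨t, h, s, h', rfl⟩
      exact ⟨(t, [s]), ⟨h, h'⟩, t, s, rfl, rfl⟩

end HeadLang

/-! ## Terms normalising in a given number of steps form a pattern language -/

/-- the pairs `(a, [σ₁, …, σ_w])` such that `a[σ₁]⋯[σ_w]` normalises in `k` steps. -/
def normClos (w k : ℕ) : Set (LTerm × List LSub) :=
  {p | p.2.length = w ∧ NormIn (p.1.closs p.2) k}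

/-- which of the ψ-rules applies first to `a[σ₁]⋯[σ_w]`, closures in the head being moved to
the list of substitutions. -/
def headShape : LTerm × List LSub → ℕ
  | (.clos _ _, _) => 0
  | (.lam _, _) => 1
  | (.app _ _, _) => 2
  | (.idx 0, .slash _ :: _) => 3
  | (.idx (_ + 1), .slash _ :: _) => 4
  | (.idx 0, .lift _ :: _) => 5
  | (.idx (_ + 1), .lift _ :: _) => 6
  | (.idx _, .shift :: _) => 7
  | (.idx _, []) => 8

theorem normClos_zero (j : ℕ) : normClos 0 j = {t | NormIn t j} ×ˢ {[]} := by
  ext ⟨t, l⟩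
  cases l <;> simp [normClos]

theorem normClos_eq_empty {w k : ℕ} (h : k < w) : normClos w k = ∅ := by
  refine Set.eq_empty_of_forall_notMem ?_
  rintro ⟨t, l⟩ ⟨rfl, hn⟩
  have := hn.width_le
  have := LTerm.length_le_width_closs t l
  dsimp only at *
  omega

theorem normClos_clos (w k : ℕ) : {p ∈ normClos w k | headShape p = 0} =
    {p | ∃ t s l, p = (.clos t s, l) ∧ (t, s :: l) ∈ normClos (w + 1) k} := by
  ext p
  constructor
  · rintro ⟨⟨rfl, h⟩, hs⟩
    revert h hs
    fun_cases headShape p <;> simp [normClos]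
  · rintro ⟨t, s, l, rfl, hl, h⟩
    exact ⟨⟨by simpa using hl, h⟩, by simp [headShape]⟩

theorem normClos_lam {w k : ℕ} (hw : w ≤ k) : {p ∈ normClos w k | headShape p = 1} =
    {p | ∃ a l, p = (.lam a, l) ∧ (a, l.map .lift) ∈ normClos w (k - w)} := by
  ext p
  constructor
  · rintro ⟨⟨rfl, h⟩, hs⟩
    revert h hs
    fun_cases headShape p with
    | case2 a l =>
      intro hs h
      obtain ⟨j, hj, hn⟩ := normIn_closs_lam_iff.1 h
      refine ⟨a, l, rfl, by simp, ?_⟩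
      dsimp only at *
      rwa [hj, Nat.add_sub_cancel]
    | _ => simp
  · rintro ⟨t, l, rfl, hl, h⟩
    simp only [List.length_map] at hl
    refine ⟨⟨hl, normIn_closs_lam_iff.2 ⟨_, ?_, h⟩⟩, by simp [headShape]⟩
    simp only [hl]
    omega

theorem normClos_app {w k : ℕ} (hw : w ≤ k) : {p ∈ normClos w k | headShape p = 2} =
    ⋃ x ∈ Finset.HasAntidiagonal.antidiagonal (k - w),
      {p | ∃ a b l, p = (.app a b, l) ∧ (a, l) ∈ normClos w x.1 ∧ (b, l) ∈ normClos w x.2} := by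
  ext p
  simp only [Set.mem_iUnion, Finset.HasAntidiagonal.mem_antidiagonal]
  constructor
  · rintro ⟨⟨rfl, h⟩, hs⟩
    revert h hs
    fun_cases headShape p with
    | case3 a b l =>
      intro _ h
      obtain ⟨i, j, hij, hi, hj⟩ := normIn_closs_app_iff.1 h
      refine ⟨(i, j), ?_, a, b, l, rfl, ⟨rfl, hi⟩, rfl, hj⟩
      dsimp only at *
      omega
    | _ => simp
  · rintro ⟨⟨i, j⟩, hij, a, b, l, rfl, ⟨hl, hi⟩, -, hj⟩
    refine ⟨⟨hl, normIn_closs_app_iff.2 ⟨i, j, ?_, hi, hj⟩⟩, by simp [headShape]⟩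
    dsimp only at *
    omega

theorem mem_normClos_cons {w k : ℕ} {a u : LTerm} {s : LSub} {l : List LSub}
    (h : NStep (.clos a s) u) :
    (a, s :: l) ∈ normClos (w + 1) (k + 1) ↔ (u, l) ∈ normClos w k := by
  have := normIn_closs_cons_iff (l := l) (k := k + 1) h
  simp_all [normClos]

theorem normClos_fvar (w k : ℕ) : {p ∈ normClos (w + 1) (k + 1) | headShape p = 3} =
    {p | ∃ a l, p = (.idx 0, .slash a :: l) ∧ (a, l) ∈ normClos w k} := by
  ext p
  constructor
  · rintro ⟨h, hs⟩
    revert h hs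
    fun_cases headShape p with
    | case4 a l => exact fun h _ => ⟨a, l, rfl, (mem_normClos_cons (.fvar a)).1 h⟩
    | _ => simp
  · rintro ⟨a, l, rfl, h⟩
    exact ⟨(mem_normClos_cons (.fvar a)).2 h, by simp [headShape]⟩

theorem normClos_rvar (w k : ℕ) : {p ∈ normClos (w + 1) (k + 1) | headShape p = 4} =
    {p | ∃ m a l, p = (.idx (m + 1), .slash a :: l) ∧ (.idx m, l) ∈ normClos w k} := by
  ext p
  constructor
  · rintro ⟨h, hs⟩
    revert h hs
    fun_cases headShape p with
    | case5 m a l => exact fun h _ => ⟨m, a, l, rfl, (mem_normClos_cons (.rvar m a)).1 h⟩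
    | _ => simp
  · rintro ⟨m, a, l, rfl, h⟩
    exact ⟨(mem_normClos_cons (.rvar m a)).2 h, by simp [headShape]⟩

theorem normClos_fvarLift (w k : ℕ) : {p ∈ normClos (w + 1) (k + 1) | headShape p = 5} =
    {p | ∃ s l, p = (.idx 0, .lift s :: l) ∧ (.idx 0, l) ∈ normClos w k} := by
  ext p
  constructor
  · rintro ⟨h, hs⟩
    revert h hs
    fun_cases headShape p with
    | case6 s l => exact fun h _ => ⟨s, l, rfl, (mem_normClos_cons (.fvarLift s)).1 h⟩
    | _ => simp
  · rintro ⟨s, l, rfl, h⟩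
    exact ⟨(mem_normClos_cons (.fvarLift s)).2 h, by simp [headShape]⟩

theorem normClos_rvarLift (w k : ℕ) : {p ∈ normClos (w + 1) (k + 1) | headShape p = 6} =
    {p | ∃ m s l, p = (.idx (m + 1), .lift s :: l) ∧
      (.idx m, s :: .shift :: l) ∈ normClos (w + 2) k} := by
  have key (m : ℕ) (s : LSub) (l : List LSub) :
      (.clos (.clos (.idx m) s) .shift, l) ∈ normClos w k ↔
        (.idx m, s :: .shift :: l) ∈ normClos (w + 2) k := by
    simp [normClos]
  ext p
  constructor
  · rintro ⟨h, hs⟩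
    revert h hs
    fun_cases headShape p with
    | case7 m s l =>
      exact fun h _ => ⟨m, s, l, rfl, (key m s l).1 ((mem_normClos_cons (.rvarLift m s)).1 h)⟩
    | _ => simp
  · rintro ⟨m, s, l, rfl, h⟩
    exact ⟨(mem_normClos_cons (.rvarLift m s)).2 ((key m s l).2 h), by simp [headShape]⟩

theorem normClos_varShift (w k : ℕ) : {p ∈ normClos (w + 1) (k + 1) | headShape p = 7} =
    {p | ∃ m l, p = (.idx m, .shift :: l) ∧ (.idx (m + 1), l) ∈ normClos w k} := by
  ext p
  constructor
  · rintro ⟨h, hs⟩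
    revert h hs
    fun_cases headShape p with
    | case8 m l => exact fun h _ => ⟨m, l, rfl, (mem_normClos_cons (.varShift m)).1 h⟩
    | _ => simp
  · rintro ⟨m, l, rfl, h⟩
    exact ⟨(mem_normClos_cons (.varShift m)).2 h, by simp [headShape]⟩

theorem normClos_nil (w k : ℕ) : {p ∈ normClos (w + 1) k | headShape p = 8} = ∅ := by
  refine Set.eq_empty_of_forall_notMem ?_
  rintro p ⟨h, hs⟩
  revert h hs
  fun_cases headShape p <;> simp [normClos]

theorem headShape_lt (p : LTerm × List LSub) : headShape p < 9 := by
  fun_cases headShape p <;> simp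

theorem patLang_setD_of_headLang {k : ℕ} (h : HeadLang k (normClos 1 k)) :
    PatLang k (setD k) := by
  refine h.termLang_clos.congr ?_
  simp [normClos]

theorem headLang_normClos (k w : ℕ) : HeadLang k (normClos (w + 1) k) := by
  induction k using Nat.strong_induction_on generalizing w with
  | _ k ih =>
    have hD : ∀ j < k, PatLang j (setD j) := fun j hj => patLang_setD_of_headLang (ih j hj 0)
    have hlt : ∀ j < k, ∀ w, HeadLang k (normClos w j) := by
      intro j hj w
      cases w with
      | zero => exact (HeadLang.prod (.norm hj) .nil).congr (normClos_zero j)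
      | succ w => exact (ih j hj w).mono hj.le
    obtain ⟨d, hd⟩ : ∃ d, k < w + 1 + d := ⟨k, by omega⟩
    induction d generalizing w with
    | zero => exact HeadLang.empty.congr (normClos_eq_empty (by omega))
    | succ d ihd =>
      rcases lt_or_ge k (w + 1) with hw | hw
      · exact HeadLang.empty.congr (normClos_eq_empty hw)
      obtain ⟨k, rfl⟩ : ∃ k', k = k' + 1 := ⟨k - 1, by omega⟩
      have key := biUnion_of_disjoint_union (C := HeadLang (k + 1)) .empty .union
        (Finset.range 9) (fun i => {p ∈ normClos (w + 1) (k + 1) | headShape p = i}) ?_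
        (fun i _ j _ hij => Set.disjoint_left.2 fun p hp hp' => hij (hp.2.symm.trans hp'.2))
      · refine key.congr ?_
        ext p
        simp [headShape_lt]
      · intro i hi
        have hk := k.lt_succ_self
        have hi : i < 9 := Finset.mem_range.1 hi
        interval_cases i
        · exact (ihd (w + 1) (by omega)).clos_pop.congr (normClos_clos _ _)
        · exact (hlt _ (by omega) _).lam.congr (normClos_lam hw)
        · refine HeadLang.congr (biUnion_of_disjoint_union (C := HeadLang (k + 1)) .empty .union
            _ _ ?_ ?_) (normClos_app hw)
          · intro x hx
            have := Finset.HasAntidiagonal.mem_antidiagonal.1 hx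
            exact (hlt _ (by omega) _).app hD (hlt _ (by omega) _)
          · intro x _ y _ hxy
            refine Set.disjoint_left.2 ?_
            rintro _ ⟨a, b, l, rfl, ⟨-, ha⟩, -, hb⟩ ⟨a', b', l', h, ⟨-, ha'⟩, -, hb'⟩
            simp only [Prod.mk.injEq, LTerm.app.injEq] at h
            obtain ⟨⟨rfl, rfl⟩, rfl⟩ := h
            exact hxy (Prod.ext (ha.unique ha') (hb.unique hb'))
        · exact (hlt k hk w).fvar.congr (normClos_fvar _ _)
        · exact ((hlt k hk w).rvar hD).congr (normClos_rvar _ _)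
        · exact (hlt k hk w).fvarLift.congr (normClos_fvarLift _ _)
        · exact ((hlt k hk (w + 2)).rvarLift hD).congr (normClos_rvarLift _ _)
        · exact (hlt k hk w).varShift.congr (normClos_varShift _ _)
        · exact HeadLang.empty.congr (normClos_nil _ _)

theorem patLang_setD (k : ℕ) : PatLang k (setD k) :=
  patLang_setD_of_headLang (headLang_normClos k 0)

/-! ## Grammars whose productions denote disjoint sets -/

/-- the set of ground terms matching a pattern, given the denotations of its non-terminals. -/
def GTerm.den {V : Type} (ρ : V → Set (GTerm Empty)) : GTerm V → Set (GTerm Empty)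
  | .var X => ρ X
  | .zero => {.zero}
  | .succ a => GTerm.succ '' a.den ρ
  | .lam a => GTerm.lam '' a.den ρ
  | .app a b => Set.image2 GTerm.app (a.den ρ) (b.den ρ)
  | .clos a b => Set.image2 GTerm.clos (a.den ρ) (b.den ρ)
  | .slash a => GTerm.slash '' a.den ρ
  | .lift a => GTerm.lift '' a.den ρ
  | .shift => {.shift}

section Grammar

variable {V : Type} {P : V → Set (GTerm V)} {ρ : V → Set (GTerm Empty)}

theorem Gen.mem_den (hρ : ∀ X, ∀ γ ∈ P X, γ.den ρ ⊆ ρ X) {α : GTerm V} {t : GTerm Empty}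
    (h : Gen P α t) : t ∈ α.den ρ := by
  induction h with
  | var hγ _ ih => exact hρ _ _ hγ ih
  | zero => rfl
  | succ _ ih => exact ⟨_, ih, rfl⟩
  | lam _ ih => exact ⟨_, ih, rfl⟩
  | app _ _ ih ih' => exact ⟨_, ih, _, ih', rfl⟩
  | clos _ _ ih ih' => exact ⟨_, ih, _, ih', rfl⟩
  | slash _ ih => exact ⟨_, ih, rfl⟩
  | lift _ ih => exact ⟨_, ih, rfl⟩
  | shift => rfl

theorem gen_of_mem_den (hρ : ∀ X, ∀ t ∈ ρ X, ∃ γ ∈ P X, t ∈ γ.den ρ) (rank : V → ℕ)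
    (hrank : ∀ X Y, .var Y ∈ P X → rank Y < rank X) (t : GTerm Empty) (α : GTerm V)
    (h : t ∈ α.den ρ) : Gen P α t := by
  have reduce (t : GTerm Empty)
      (ht : ∀ α : GTerm V, (∀ X, α ≠ .var X) → t ∈ α.den ρ → Gen P α t)
      (α : GTerm V) (h : t ∈ α.den ρ) : Gen P α t := by
    by_cases hα : ∃ X, α = .var X
    · obtain ⟨X, rfl⟩ := hα
      induction hr : rank X using Nat.strong_induction_on generalizing X with
      | _ r ih =>
        obtain ⟨γ, hγ, hm⟩ := hρ X t h
        by_cases hv : ∃ Y, γ = .var Y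
        · obtain ⟨Y, rfl⟩ := hv
          exact .var hγ (ih _ (hr ▸ hrank X Y hγ) Y hm rfl)
        · exact .var hγ (ht γ (fun Y hY => hv ⟨Y, hY⟩) hm)
    · exact ht α (fun X hX => hα ⟨X, hX⟩) h
  induction t generalizing α with
  | var v => exact v.elim
  | zero =>
    refine reduce _ (fun α hα h => ?_) α h
    cases α with
    | var X => exact (hα X rfl).elim
    | zero => exact .zero
    | _ => simp [GTerm.den] at h
  | succ t ih =>
    refine reduce _ (fun α hα h => ?_) α h
    cases α with
    | var X => exact (hα X rfl).elim
    | succ a => exact .succ (ih _ (by simpa [GTerm.den] using h))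
    | _ => simp [GTerm.den] at h
  | lam t ih =>
    refine reduce _ (fun α hα h => ?_) α h
    cases α with
    | var X => exact (hα X rfl).elim
    | lam a => exact .lam (ih _ (by simpa [GTerm.den] using h))
    | _ => simp [GTerm.den] at h
  | app t u ih ih' =>
    refine reduce _ (fun α hα h => ?_) α h
    cases α with
    | var X => exact (hα X rfl).elim
    | app a b =>
      rw [GTerm.den, app_mem_image2] at h
      exact .app (ih _ h.1) (ih' _ h.2)
    | _ => simp [GTerm.den] at h
  | clos t u ih ih' =>
    refine reduce _ (fun α hα h => ?_) α h
    cases α with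
    | var X => exact (hα X rfl).elim
    | clos a b =>
      rw [GTerm.den, clos_mem_image2] at h
      exact .clos (ih _ h.1) (ih' _ h.2)
    | _ => simp [GTerm.den] at h
  | slash t ih =>
    refine reduce _ (fun α hα h => ?_) α h
    cases α with
    | var X => exact (hα X rfl).elim
    | slash a => exact .slash (ih _ (by simpa [GTerm.den] using h))
    | _ => simp [GTerm.den] at h
  | lift t ih =>
    refine reduce _ (fun α hα h => ?_) α h
    cases α with
    | var X => exact (hα X rfl).elim
    | lift a => exact .lift (ih _ (by simpa [GTerm.den] using h))
    | _ => simp [GTerm.den] at h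
  | shift =>
    refine reduce _ (fun α hα h => ?_) α h
    cases α with
    | var X => exact (hα X rfl).elim
    | shift => exact .shift
    | _ => simp [GTerm.den] at h

theorem Parse.gen {α : GTerm V} {t : GTerm Empty} (p : Parse P α t) : Gen P α t := by
  induction p with
  | var hγ _ ih => exact .var hγ ih
  | zero => exact .zero
  | succ _ ih => exact .succ ih
  | lam _ ih => exact .lam ih
  | app _ _ ih ih' => exact .app ih ih'
  | clos _ _ ih ih' => exact .clos ih ih'
  | slash _ ih => exact .slash ih
  | lift _ ih => exact .lift ih
  | shift => exact .shift

theorem Parse.unique (hρ : ∀ X, ∀ γ ∈ P X, γ.den ρ ⊆ ρ X)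
    (hd : ∀ X, ∀ γ ∈ P X, ∀ γ' ∈ P X, ∀ t ∈ γ.den ρ, t ∈ γ'.den ρ → γ = γ')
    {α : GTerm V} {t : GTerm Empty} (p q : Parse P α t) : p = q := by
  induction p with
  | var hγ p ih =>
    cases q with
    | var hγ' q =>
      obtain rfl := hd _ _ hγ _ hγ' _ (p.gen.mem_den hρ) (q.gen.mem_den hρ)
      rw [ih q]
  | zero => cases q; rfl
  | succ _ ih => cases q with | succ q => rw [ih q]
  | lam _ ih => cases q with | lam q => rw [ih q]
  | app _ _ ih ih' => cases q with | app q q' => rw [ih q, ih' q']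
  | clos _ _ ih ih' => cases q with | clos q q' => rw [ih q, ih' q']
  | slash _ ih => cases q with | slash q => rw [ih q]
  | lift _ ih => cases q with | lift q => rw [ih q]
  | shift => cases q; rfl

end Grammar

/-! ## The simple ψ-reduction grammar -/

namespace NT

variable {n : ℕ}

/-- the intended language of each non-terminal. -/
def den : NT n → Set (GTerm Empty)
  | T => setT
  | S => setS
  | N => setN
  | G k => setG k

/-- the non-terminal is `T`, `S`, `N` or some `G_j` with `j < k`. -/
def Below (k : ℕ) (X : NT n) : Prop :=
  X = T ∨ X = S ∨ X = N ∨ ∃ j : Fin (n + 1), X = G j ∧ (j : ℕ) < k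

/-- a ranking of the non-terminals that decreases along unit productions. -/
def rank : NT n → ℕ
  | T => 1
  | S => 0
  | N => 0
  | G k => k + 2

theorem Below.rank_lt {k : Fin (n + 1)} {X : NT n} (h : X.Below k) : X.rank < (G k).rank := by
  rcases h with rfl | rfl | rfl | ⟨j, rfl, hj⟩ <;> simp [rank]
  exact hj

end NT

/-- a finite set `Φ` of patterns over `T, S, N, G_0, …, G_{k-1}` denoting disjoint sets whose
union is `A`. -/
structure IsPatternSet {n : ℕ} (k : ℕ) (A : Set (GTerm Empty)) (Φ : Set (GTerm (NT n))) :
    Prop where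
  finite : Φ.Finite
  below : ∀ α ∈ Φ, ∀ X, Occurs X α → X.Below k
  disjoint : ∀ α ∈ Φ, ∀ β ∈ Φ, ∀ x ∈ α.den NT.den, x ∈ β.den NT.den → α = β
  mem_iff : ∀ x, x ∈ A ↔ ∃ α ∈ Φ, x ∈ α.den NT.den

namespace IsPatternSet

variable {n k : ℕ} {A B : Set (GTerm Empty)} {Φ Ψ : Set (GTerm (NT n))}

theorem singleton (α : GTerm (NT n)) (h : ∀ X, Occurs X α → X.Below k) :
    IsPatternSet k (α.den NT.den) {α} where
  finite := Set.finite_singleton α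
  below := by simpa using h
  disjoint := by simp
  mem_iff := by simp

theorem union (hA : IsPatternSet k A Φ) (hB : IsPatternSet k B Ψ) (h : Disjoint A B) :
    IsPatternSet k (A ∪ B) (Φ ∪ Ψ) where
  finite := hA.finite.union hB.finite
  below := by
    rintro α (hα | hα)
    · exact hA.below α hα
    · exact hB.below α hα
  disjoint := by
    have key : ∀ α ∈ Φ, ∀ β ∈ Ψ, ∀ x ∈ α.den NT.den, x ∉ β.den NT.den := fun α hα β hβ x hx hx' =>
      Set.disjoint_left.1 h ((hA.mem_iff x).2 ⟨α, hα, hx⟩) ((hB.mem_iff x).2 ⟨β, hβ, hx'⟩)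
    rintro α (hα | hα) β (hβ | hβ) x hx hx'
    · exact hA.disjoint α hα β hβ x hx hx'
    · exact (key α hα β hβ x hx hx').elim
    · exact (key β hβ α hα x hx' hx).elim
    · exact hB.disjoint α hα β hβ x hx hx'
  mem_iff x := by simp [hA.mem_iff, hB.mem_iff, or_and_right, exists_or]

theorem image {f : GTerm (NT n) → GTerm (NT n)} {g : GTerm Empty → GTerm Empty}
    (h : IsPatternSet k A Φ) (hg : g.Injective)
    (hf : ∀ α, (f α).den NT.den = g '' α.den NT.den)
    (hocc : ∀ X α, Occurs X (f α) → Occurs X α) : IsPatternSet k (g '' A) (f '' Φ) where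
  finite := h.finite.image f
  below := by
    rintro _ ⟨α, hα, rfl⟩ X hX
    exact h.below α hα X (hocc X α hX)
  disjoint := by
    rintro _ ⟨α, hα, rfl⟩ _ ⟨β, hβ, rfl⟩ x hx hx'
    rw [hf] at hx hx'
    obtain ⟨y, hy, rfl⟩ := hx
    rw [h.disjoint α hα β hβ y hy (hg.mem_set_image.1 hx')]
  mem_iff x := by
    constructor
    · rintro ⟨y, hy, rfl⟩
      obtain ⟨α, hα, hy⟩ := (h.mem_iff y).1 hy
      exact ⟨_, ⟨α, hα, rfl⟩, hf α ▸ ⟨y, hy, rfl⟩⟩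
    · rintro ⟨_, ⟨α, hα, rfl⟩, hx⟩
      rw [hf] at hx
      obtain ⟨y, hy, rfl⟩ := hx
      exact ⟨y, (h.mem_iff y).2 ⟨α, hα, hy⟩, rfl⟩

theorem image2 {f : GTerm (NT n) → GTerm (NT n) → GTerm (NT n)}
    {g : GTerm Empty → GTerm Empty → GTerm Empty} (hA : IsPatternSet k A Φ)
    (hB : IsPatternSet k B Ψ) (hg : Function.Injective2 g)
    (hf : ∀ α β, (f α β).den NT.den = Set.image2 g (α.den NT.den) (β.den NT.den))
    (hocc : ∀ X α β, Occurs X (f α β) → Occurs X α ∨ Occurs X β) :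
    IsPatternSet k (Set.image2 g A B) (Set.image2 f Φ Ψ) where
  finite := hA.finite.image2 f hB.finite
  below := by
    rintro _ ⟨α, hα, β, hβ, rfl⟩ X hX
    exact (hocc X α β hX).elim (hA.below α hα X) (hB.below β hβ X)
  disjoint := by
    rintro _ ⟨α, hα, β, hβ, rfl⟩ _ ⟨α', hα', β', hβ', rfl⟩ x hx hx'
    rw [hf] at hx hx'
    obtain ⟨y, hy, z, hz, rfl⟩ := hx
    rw [Set.mem_image2_iff hg] at hx'
    rw [hA.disjoint α hα α' hα' y hy hx'.1, hB.disjoint β hβ β' hβ' z hz hx'.2]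
  mem_iff x := by
    constructor
    · rintro ⟨y, hy, z, hz, rfl⟩
      obtain ⟨α, hα, hy⟩ := (hA.mem_iff y).1 hy
      obtain ⟨β, hβ, hz⟩ := (hB.mem_iff z).1 hz
      exact ⟨_, ⟨α, hα, β, hβ, rfl⟩, hf α β ▸ ⟨y, hy, z, hz, rfl⟩⟩
    · rintro ⟨_, ⟨α, hα, β, hβ, rfl⟩, hx⟩
      rw [hf] at hx
      obtain ⟨y, hy, z, hz, rfl⟩ := hx
      exact ⟨y, (hA.mem_iff y).2 ⟨α, hα, hy⟩, z, (hB.mem_iff z).2 ⟨β, hβ, hz⟩, rfl⟩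

end IsPatternSet

theorem PatLang.exists_isPatternSet {n k : ℕ} {A : Set (GTerm Empty)} (h : PatLang k A)
    (hk : k ≤ n + 1) : ∃ Φ : Set (GTerm (NT n)), IsPatternSet k A Φ := by
  induction h with
  | empty => exact ⟨∅, Set.finite_empty, by simp, by simp, by simp⟩
  | union _ _ h ih ih' =>
    obtain ⟨Φ, hΦ⟩ := ih
    obtain ⟨Ψ, hΨ⟩ := ih'
    exact ⟨_, hΦ.union hΨ h⟩
  | terms => exact ⟨_, .singleton (.var .T) fun X hX => .inl hX⟩
  | subs => exact ⟨_, .singleton (.var .S) fun X hX => .inr (.inl hX)⟩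
  | indices => exact ⟨_, .singleton (.var .N) fun X hX => .inr (.inr (.inl hX))⟩
  | @norm j hj =>
    exact ⟨_, .singleton (.var (.G ⟨j, hj.trans_le hk⟩))
      fun X hX => .inr (.inr (.inr ⟨_, hX, hj⟩))⟩
  | zero => exact ⟨_, .singleton .zero fun _ => False.elim⟩
  | shift => exact ⟨_, .singleton .shift fun _ => False.elim⟩
  | succ _ ih =>
    obtain ⟨Φ, hΦ⟩ := ih
    exact ⟨_, hΦ.image (f := .succ) (fun _ _ => GTerm.succ.inj) (fun _ => rfl) fun _ _ => id⟩
  | lam _ ih =>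
    obtain ⟨Φ, hΦ⟩ := ih
    exact ⟨_, hΦ.image (f := .lam) (fun _ _ => GTerm.lam.inj) (fun _ => rfl) fun _ _ => id⟩
  | slash _ ih =>
    obtain ⟨Φ, hΦ⟩ := ih
    exact ⟨_, hΦ.image (f := .slash) (fun _ _ => GTerm.slash.inj) (fun _ => rfl) fun _ _ => id⟩
  | lift _ ih =>
    obtain ⟨Φ, hΦ⟩ := ih
    exact ⟨_, hΦ.image (f := .lift) (fun _ _ => GTerm.lift.inj) (fun _ => rfl) fun _ _ => id⟩
  | app _ _ ih ih' =>
    obtain ⟨Φ, hΦ⟩ := ih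
    obtain ⟨Ψ, hΨ⟩ := ih'
    exact ⟨_, hΦ.image2 (f := .app) hΨ (fun _ _ _ _ => GTerm.app.inj) (fun _ _ => rfl)
      fun _ _ _ => id⟩
  | clos _ _ ih ih' =>
    obtain ⟨Φ, hΦ⟩ := ih
    obtain ⟨Ψ, hΨ⟩ := ih'
    exact ⟨_, hΦ.image2 (f := .clos) hΨ (fun _ _ _ _ => GTerm.clos.inj) (fun _ _ => rfl)
      fun _ _ _ => id⟩

/-- the productions of `G_k` that do not generate closures at the root. -/
def closFreeProds {n : ℕ} (k : Fin (n + 1)) : Set (GTerm (NT n)) :=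
  {.lam (.var (.G k))} ∪
    {α | ∃ i j : Fin (n + 1), (i : ℕ) + j = k ∧ α = .app (.var (.G i)) (.var (.G j))} ∪
    {α | (k : ℕ) = 0 ∧ α = .var .N}

/-- the productions of the ψ-reduction grammar, given patterns `Φ k` for the closures
normalising in `k` steps. -/
def redProds {n : ℕ} (Φ : Fin (n + 1) → Set (GTerm (NT n))) : NT n → Set (GTerm (NT n))
  | .G k => closFreeProds k ∪ Φ k
  | X => lamProds X

section Productions

variable {n : ℕ} {Φ : Fin (n + 1) → Set (GTerm (NT n))}

theorem redProds_finite (hΦ : ∀ k : Fin (n + 1), IsPatternSet k (setD k) (Φ k)) (X : NT n) :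
    (redProds Φ X).Finite := by
  cases X with
  | G k =>
    refine (((Set.finite_singleton _).union ?_).union ?_).union (hΦ k).finite
    · refine (Set.finite_range fun p : Fin (n + 1) × Fin (n + 1) =>
        GTerm.app (.var (NT.G p.1)) (.var (NT.G p.2))).subset ?_
      rintro _ ⟨i, j, -, rfl⟩
      exact ⟨(i, j), rfl⟩
    · exact (Set.finite_singleton (GTerm.var NT.N)).subset fun α hα => hα.2
  | _ => simp [redProds, lamProds]

theorem exists_clos_of_mem_setD {x : GTerm Empty} {k : ℕ} (h : x ∈ setD k) :
    ∃ y z, x = .clos y z := by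
  obtain ⟨_, ⟨a, s, rfl, -⟩, rfl⟩ := h
  exact ⟨_, _, rfl⟩

theorem den_subset_of_mem_redProds
    (hΦ : ∀ k : Fin (n + 1), IsPatternSet k (setD k) (Φ k)) (X : NT n)
    (α : GTerm (NT n)) (hα : α ∈ redProds Φ X) : α.den NT.den ⊆ X.den := by
  cases X with
  | G k =>
    rcases hα with ((rfl | ⟨i, j, hij, rfl⟩) | ⟨hk, rfl⟩) | hα
    · rintro _ ⟨x, hx, rfl⟩
      exact lam_mem_setG.2 hx
    · rintro _ ⟨x, hx, y, hy, rfl⟩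
      exact app_mem_setG.2 ⟨i, j, hij, hx, hy⟩
    · intro x hx
      simpa [NT.den, hk] using setN_subset_setG_zero hx
    · intro x hx
      have hx := ((hΦ k).mem_iff x).2 ⟨α, hα, hx⟩
      obtain ⟨y, z, rfl⟩ := exists_clos_of_mem_setD hx
      exact clos_mem_setG.2 hx
  | T =>
    rcases hα with rfl | rfl | rfl | rfl
    · exact setN_subset_setT
    · rintro _ ⟨x, hx, rfl⟩
      exact lam_mem_setT.2 hx
    · rintro _ ⟨x, hx, y, hy, rfl⟩
      exact app_mem_setT.2 ⟨hx, hy⟩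
    · rintro _ ⟨x, hx, y, hy, rfl⟩
      exact clos_mem_setT.2 ⟨hx, hy⟩
  | S =>
    rcases hα with rfl | rfl | rfl
    · rintro _ ⟨x, hx, rfl⟩
      exact slash_mem_setS.2 hx
    · rintro _ ⟨x, hx, rfl⟩
      exact lift_mem_setS.2 hx
    · rintro _ rfl
      exact shift_mem_setS
  | N =>
    rcases hα with rfl | rfl
    · rintro _ rfl
      exact zero_mem_setN
    · rintro _ ⟨x, hx, rfl⟩
      exact succ_mem_setN.2 hx

theorem exists_redProds_of_mem_den
    (hΦ : ∀ k : Fin (n + 1), IsPatternSet k (setD k) (Φ k)) (X : NT n)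
    (x : GTerm Empty) (hx : x ∈ X.den) : ∃ α ∈ redProds Φ X, x ∈ α.den NT.den := by
  cases X with
  | G k =>
    simp only [NT.den] at hx
    cases x using GTerm.ground_cases with
    | zero => exact ⟨.var .N, .inl (.inr ⟨zero_mem_setG.1 hx, rfl⟩), zero_mem_setN⟩
    | succ x =>
      obtain ⟨hk, hx⟩ := succ_mem_setG.1 hx
      exact ⟨.var .N, .inl (.inr ⟨hk, rfl⟩), succ_mem_setN.2 hx⟩
    | lam x => exact ⟨_, .inl (.inl (.inl rfl)), x, lam_mem_setG.1 hx, rfl⟩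
    | app x y =>
      obtain ⟨i, j, hij, hi, hj⟩ := app_mem_setG.1 hx
      exact ⟨_, .inl (.inl (.inr ⟨⟨i, by omega⟩, ⟨j, by omega⟩, hij, rfl⟩)), x, hi, y, hj, rfl⟩
    | clos x y =>
      obtain ⟨α, hα, hx⟩ := ((hΦ k).mem_iff _).1 (clos_mem_setG.1 hx)
      exact ⟨α, .inr hα, hx⟩
    | _ => simp at hx
  | T =>
    simp only [NT.den] at hx
    cases x using GTerm.ground_cases with
    | zero => exact ⟨.var .N, by simp [redProds, lamProds], zero_mem_setN⟩
    | succ x =>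
      exact ⟨.var .N, by simp [redProds, lamProds], succ_mem_setN.2 (succ_mem_setT.1 hx)⟩
    | lam x => exact ⟨.lam (.var .T), by simp [redProds, lamProds], x, lam_mem_setT.1 hx, rfl⟩
    | app x y =>
      obtain ⟨hx, hy⟩ := app_mem_setT.1 hx
      exact ⟨.app (.var .T) (.var .T), by simp [redProds, lamProds], x, hx, y, hy, rfl⟩
    | clos x y =>
      obtain ⟨hx, hy⟩ := clos_mem_setT.1 hx
      exact ⟨.clos (.var .T) (.var .S), by simp [redProds, lamProds], x, hx, y, hy, rfl⟩
    | _ => simp at hx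
  | S =>
    simp only [NT.den] at hx
    cases x using GTerm.ground_cases with
    | slash x =>
      exact ⟨.slash (.var .T), by simp [redProds, lamProds], x, slash_mem_setS.1 hx, rfl⟩
    | lift x => exact ⟨.lift (.var .S), by simp [redProds, lamProds], x, lift_mem_setS.1 hx, rfl⟩
    | shift => exact ⟨.shift, by simp [redProds, lamProds], rfl⟩
    | _ => simp at hx
  | N =>
    simp only [NT.den] at hx
    cases x using GTerm.ground_cases with
    | zero => exact ⟨.zero, by simp [redProds, lamProds], rfl⟩
    | succ x => exact ⟨.succ (.var .N), by simp [redProds, lamProds], x, succ_mem_setN.1 hx, rfl⟩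
    | _ => simp at hx

theorem eq_of_mem_den_redProds (hΦ : ∀ k : Fin (n + 1), IsPatternSet k (setD k) (Φ k)) (X : NT n)
    (α : GTerm (NT n)) (hα : α ∈ redProds Φ X) (β : GTerm (NT n)) (hβ : β ∈ redProds Φ X)
    (x : GTerm Empty) (hx : x ∈ α.den NT.den) (hx' : x ∈ β.den NT.den) : α = β := by
  cases X with
  | G k =>
    have hclos : ∀ γ ∈ Φ k, x ∈ γ.den NT.den → ∃ y z, x = .clos y z := fun γ hγ h =>
      exists_clos_of_mem_setD (((hΦ k).mem_iff x).2 ⟨γ, hγ, h⟩)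
    have hfree : ∀ γ ∈ closFreeProds k, x ∈ γ.den NT.den → ¬ ∃ y z, x = .clos y z := by
      rintro _ ((rfl | ⟨i, j, -, rfl⟩) | ⟨-, rfl⟩) h ⟨y, z, rfl⟩ <;>
      simp [GTerm.den, NT.den] at h
    rcases hα with hα | hα <;> rcases hβ with hβ | hβ
    · rcases hα with (rfl | ⟨i, j, hij, rfl⟩) | ⟨hk, rfl⟩ <;>
      rcases hβ with (rfl | ⟨i', j', hij', rfl⟩) | ⟨hk', rfl⟩ <;>
      cases x using GTerm.ground_cases <;> simp [GTerm.den, NT.den] at hx hx' ⊢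
      exact ⟨Fin.ext (eq_of_mem_setG hx.1 hx'.1), Fin.ext (eq_of_mem_setG hx.2 hx'.2)⟩
    · exact (hfree α hα hx (hclos β hβ hx')).elim
    · exact (hfree β hβ hx' (hclos α hα hx)).elim
    · exact (hΦ k).disjoint α hα β hβ x hx hx'
  | T =>
    rcases hα with rfl | rfl | rfl | rfl <;> rcases hβ with rfl | rfl | rfl | rfl <;>
    cases x using GTerm.ground_cases <;> simp [GTerm.den, NT.den] at hx hx' ⊢
  | S =>
    rcases hα with rfl | rfl | rfl <;> rcases hβ with rfl | rfl | rfl <;>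
    cases x using GTerm.ground_cases <;> simp [GTerm.den] at hx hx' ⊢
  | N =>
    rcases hα with rfl | rfl <;> rcases hβ with rfl | rfl <;>
    cases x using GTerm.ground_cases <;> simp [GTerm.den] at hx hx' ⊢

theorem rank_lt_of_var_mem_redProds
    (hΦ : ∀ k : Fin (n + 1), IsPatternSet k (setD k) (Φ k)) (X Y : NT n)
    (h : .var Y ∈ redProds Φ X) : Y.rank < X.rank := by
  cases X with
  | G k =>
    rcases h with ((h | ⟨i, j, hij, h⟩) | ⟨hk, h⟩) | h
    · simp at h
    · simp at h
    · obtain rfl : Y = .N := GTerm.var.inj h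
      simp [NT.rank]
    · exact NT.Below.rank_lt ((hΦ k).below _ h Y rfl)
  | _ =>
    simp [redProds, lamProds] at h
    try simp [h, NT.rank]

/-- the ψ-reduction grammar, given patterns `Φ k` for the closures normalising in `k` steps. -/
def redGrammar (hΦ : ∀ k : Fin (n + 1), IsPatternSet k (setD k) (Φ k)) : RTG (NT n) where
  ax := .G (Fin.last n)
  prods := redProds Φ
  prods_fin := redProds_finite hΦ

theorem isRG_redGrammar (hΦ : ∀ k : Fin (n + 1), IsPatternSet k (setD k) (Φ k)) :
    IsRG n (redGrammar hΦ) where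
  ax_eq := rfl
  lambda_sub X := by
    cases X with
    | G k => exact Set.empty_subset _
    | _ => exact subset_rfl
  unamb _ _ := ⟨Parse.unique (den_subset_of_mem_redProds hΦ) (eq_of_mem_den_redProds hΦ)⟩
  lang k := by
    ext t
    exact ⟨Gen.mem_den (den_subset_of_mem_redProds hΦ),
      gen_of_mem_den (exists_redProds_of_mem_den hΦ) NT.rank (rank_lt_of_var_mem_redProds hΦ) t
        (.var (.G k))⟩

theorem isSimple_redGrammar (hΦ : ∀ k : Fin (n + 1), IsPatternSet k (setD k) (Φ k)) :
    IsSimple n (redGrammar hΦ) where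
  selfref X α hα hX := by
    cases X with
    | G k =>
      refine .inr ⟨k, rfl, ?_⟩
      rcases hα with ((rfl | ⟨i, j, hij, rfl⟩) | ⟨hk, rfl⟩) | hα
      · exact .inl rfl
      · rcases hX with hX | hX
        · obtain rfl : k = i := NT.G.inj hX
          obtain rfl : j = 0 := Fin.ext (by simpa using hij)
          exact .inr (.inr rfl)
        · obtain rfl : k = j := NT.G.inj hX
          obtain rfl : i = 0 := Fin.ext (by simpa using hij)
          exact .inr (.inl rfl)
      · simp [Occurs] at hX
      · exact ((hΦ k).below α hα _ hX).rank_lt.false.elim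
    | _ => exact .inl hα
  regular k α hα hk Y hY := by
    rcases hα with ((rfl | ⟨i, j, hij, rfl⟩) | ⟨-, rfl⟩) | hα
    · exact (hk rfl).elim
    · have hi : k ≠ i := fun h => hk (.inl (congrArg NT.G h))
      have hj : k ≠ j := fun h => hk (.inr (congrArg NT.G h))
      refine .inr (.inr (.inr ?_))
      rcases hY with rfl | rfl
      · exact ⟨i, rfl, by omega⟩
      · exact ⟨j, rfl, by omega⟩
    · exact .inr (.inr (.inl hY))
    · exact (hΦ k).below α hα Y hY

end Productions

/-- For every n ≥ 0 there exists a simple ψ-reduction grammar 𝒢_n; in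
particular, the set of λυ-terms ψ-normalising in exactly n normal-order
ψ-reduction steps is a regular tree language generated by a regular tree
grammar over the λυ signature whose axiom is unambiguous. -/
theorem exists_simple_reduction_grammar (n : Nat) :
    ∃ G : RTG (NT n), IsRG n G ∧ IsSimple n G ∧
      Unambiguous G.prods G.ax ∧
      Lang G.prods (.var G.ax) = {g | ∃ t : LTerm, NormIn t n ∧ encT t = g} := by
  choose Φ hΦ using fun k : Fin (n + 1) =>
    (patLang_setD k).exists_isPatternSet (n := n) (by omega)
  have h := isRG_redGrammar hΦ
  exact ⟨redGrammar hΦ, h, isSimple_redGrammar hΦ, h.unamb _, h.lang (Fin.last n)⟩
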